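/- arXiv:2204.04810 — 3 statements merged into one kernel-verified Lean document; each statement's English description precedes it below -/
import Mathlib

section
/- Suppose there exists a random d×d matrix H such that (1/n)·Σ_{m=1}^n ‖H_m − H‖ → 0 a.s., with probability one H(ω) satisfies Assumption A3 (with λ_H(ω), right eigenvector u(ω) and S_{H(ω)} depending on ω), and ‖M_{n,2}‖/n → 0 a.s. Then almost surely dist(Y_n/n, λ_H·S_H) → 0, dist(Y_n⁺/n, λ_H·S_H) → 0, dist(Y_n⁺/α(Y_n⁺), S_H) → 0 and dist(N_n/n, S_H) → 0. If moreover H is irreducible almost surely, then S_H consists of a single (random) point v, and Y_n/n → λ_H·v, Y_n⁺/α(Y_n⁺) → v, N_n/n → v almost surely. -/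
open MeasureTheory Filter Topology Finset ProbabilityTheory Asymptotics

noncomputable section

namespace Urn

variable {Ω : Type*} {d : ℕ}

/-- componentwise positive part of a vector -/
def vpos (x : Fin d → ℝ) : Fin d → ℝ := fun k => max (x k) 0

/-- componentwise negative part of a vector -/
def vneg (x : Fin d → ℝ) : Fin d → ℝ := fun k => max (-(x k)) 0

/-- sum of the coordinates, `α(x)` -/
def asum (x : Fin d → ℝ) : ℝ := ∑ k, x k

/-- standard basis row vector `e k` -/
def basis (k : Fin d) : Fin d → ℝ := fun j => if j = k then 1 else 0

/-- row vector times matrix, `x · A` -/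
def rmul (x : Fin d → ℝ) (A : Fin d → Fin d → ℝ) : Fin d → ℝ :=
  fun q => ∑ k, x k * A k q

/-- matrix times column vector, `A · xᵗ` -/
def cmul (A : Fin d → Fin d → ℝ) (x : Fin d → ℝ) : Fin d → ℝ :=
  fun q => ∑ k, A q k * x k

/-- the set of complex eigenvalues of a real matrix -/
def spec (H : Fin d → Fin d → ℝ) : Set ℂ :=
  spectrum ℂ ((Matrix.of H).map (fun x : ℝ => (x : ℂ)))

/-- `λ_H`: the largest real part of the complex eigenvalues of `H` -/
def lamH (H : Fin d → Fin d → ℝ) : ℝ :=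
  sSup (Complex.re '' spec H)

/-- the simplex `Δ^d` -/
def simplex (d : ℕ) : Set (Fin d → ℝ) :=
  {v | (∀ k, 0 ≤ v k) ∧ ∑ k, v k = 1}

/-- `S_H`: scaled nonnegative left eigenvectors of `H` for `λ_H` -/
def SH (H : Fin d → Fin d → ℝ) : Set (Fin d → ℝ) :=
  {v | v ∈ simplex d ∧ rmul v H = lamH H • v}

/-- `λ_H · S_H` -/
def lamSH (H : Fin d → Fin d → ℝ) : Set (Fin d → ℝ) :=
  (fun v => lamH H • v) '' SH H

/-- irreducibility of a matrix: strong connectivity of the digraph of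
nonzero off-diagonal entries -/
def Irred (H : Fin d → Fin d → ℝ) : Prop :=
  ∀ k q : Fin d, k ≠ q → Relation.TransGen (fun i j => i ≠ j ∧ H i j ≠ 0) k q

/-- Assumption A3 for a matrix `H` -/
def A3 (H : Fin d → Fin d → ℝ) : Prop :=
  (∀ q k, q ≠ k → 0 ≤ H q k) ∧
  (∃ u : Fin d → ℝ, (∀ k, 0 < u k) ∧ cmul H u = lamH H • u) ∧
  0 < lamH H

/-- Assumption A2: entries of `D_1` are integrable with mean matrix `H` -/
def A2 {m0 : MeasurableSpace Ω} (μ : Measure Ω) (D : ℕ → Ω → Fin d → Fin d → ℝ)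
    (H : Fin d → Fin d → ℝ) : Prop :=
  ∀ k q, Integrable (fun ω => D 1 ω k q) μ ∧ H k q = ∫ ω, D 1 ω k q ∂μ

/-- Assumption A1: the replacement matrices are identically distributed and
`D_{n+1}` is independent of `ℱ_n` -/
def IsIID {m0 : MeasurableSpace Ω} (μ : Measure Ω) (ℱ : Filtration ℕ m0)
    (D : ℕ → Ω → Fin d → Fin d → ℝ) : Prop :=
  (∀ n, 1 ≤ n → Measurable (D n)) ∧
  (∀ n, 1 ≤ n → μ.map (D n) = μ.map (D 1)) ∧
  (∀ n, Indep (MeasurableSpace.comap (D (n+1)) inferInstance) (ℱ n) μ)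

/-- the generalized Friedman urn model dynamics -/
def IsUrnModel {m0 : MeasurableSpace Ω} (μ : Measure Ω) (ℱ : Filtration ℕ m0)
    (D : ℕ → Ω → Fin d → Fin d → ℝ) (X : ℕ → Ω → Fin d → ℝ)
    (Y : ℕ → Ω → Fin d → ℝ) (p : Fin d → ℝ) : Prop :=
  (∀ ω ω', Y 0 ω = Y 0 ω') ∧
  (∀ ω, (∀ k, 0 ≤ Y 0 ω k) ∧ Y 0 ω ≠ 0) ∧
  (∀ n ω, Y (n+1) ω = Y n ω + rmul (X (n+1) ω) (D (n+1) ω)) ∧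
  (∀ k, 0 ≤ p k) ∧ (∑ k, p k = 1) ∧
  (∀ n ω, ∃ k, X (n+1) ω = basis k) ∧
  (∀ n, 1 ≤ n → Measurable[ℱ n] (X n)) ∧
  (∀ n, 1 ≤ n → Measurable[ℱ n] (D n)) ∧
  (∀ n (k : Fin d),
    (μ[fun ω => X (n+1) ω k | ℱ n]) =ᵐ[μ]
      fun ω => if 0 < asum (vpos (Y n ω))
        then vpos (Y n ω) k / asum (vpos (Y n ω)) else p k)

/-- `H_n = E[D_n | ℱ_{n-1}]` entrywise -/
def IsCondMean {m0 : MeasurableSpace Ω} (μ : Measure Ω) (ℱ : Filtration ℕ m0)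
    (D Hc : ℕ → Ω → Fin d → Fin d → ℝ) : Prop :=
  ∀ n k q, Integrable (fun ω => D (n+1) ω k q) μ ∧
    (fun ω => Hc (n+1) ω k q) =ᵐ[μ] μ[fun ω => D (n+1) ω k q | ℱ n]

/-- the martingale `M_{n,2} = ∑_{m=1}^n X_m (D_m − H_m)` -/
def M2 (X : ℕ → Ω → Fin d → ℝ) (D Hc : ℕ → Ω → Fin d → Fin d → ℝ)
    (n : ℕ) (ω : Ω) : Fin d → ℝ :=
  fun q => ∑ m ∈ Finset.Icc 1 n, ∑ k, X m ω k * (D m ω k q - Hc m ω k q)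

/-- the draw counts `N_n = ∑_{m=1}^n X_m` -/
def Ncount (X : ℕ → Ω → Fin d → ℝ) (n : ℕ) (ω : Ω) : Fin d → ℝ :=
  fun k => ∑ m ∈ Finset.Icc 1 n, X m ω k

/-- `ρ`: ratio of the second largest real part of the eigenvalues to `λ_H` -/
def rho (H : Fin d → Fin d → ℝ) : ℝ :=
  sSup {x | ∃ z ∈ spec H, z.re = x ∧ x < lamH H} / lamH H

/-- `ν_sec`: largest algebraic multiplicity among the eigenvalues with the
second largest real part -/
def nusec (H : Fin d → Fin d → ℝ) : ℕ :=
  sSup {m | ∃ z ∈ spec H, z.re = rho H * lamH H ∧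
    m = Polynomial.rootMultiplicity z
      (Matrix.charpoly ((Matrix.of H).map (fun x : ℝ => (x : ℂ))))}

/-- the rate sequence `b_n` -/
def bseq (r : ℝ) (ν : ℕ) (n : ℕ) : ℝ :=
  if 1/2 < r then (n:ℝ) ^ (r - 1) * (Real.log n) ^ (ν - 1)
  else if r = 1/2 then
    Real.sqrt (Real.log (Real.log n)) * (Real.log n) ^ (ν - 1) / Real.sqrt n
  else Real.sqrt (Real.log (Real.log n)) / Real.sqrt n

theorem icc_nonempty (n : ℕ) (T : ℝ) (hT : 1 ≤ T) :
    (Finset.Icc n ⌊(n:ℝ) * T⌋₊).Nonempty :=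
  ⟨n, Finset.mem_Icc.mpr ⟨le_rfl,
    Nat.le_floor (le_mul_of_one_le_right (Nat.cast_nonneg n) hT)⟩⟩

end Urn

theorem sum_choose_mul_sq (N : ℕ) :
    ∑ k ∈ range (N + 1), (N.choose k : ℝ) * ((N : ℝ) - 2 * k) ^ 2 = (N : ℝ) * 2 ^ N := by
  have h := congrArg (Polynomial.eval (1 / 2 : ℝ)) (bernsteinPolynomial.variance ℝ N)
  simp only [Polynomial.eval_finsetSum, Polynomial.eval_mul, Polynomial.eval_pow,
    Polynomial.eval_sub, Polynomial.eval_X, Polynomial.eval_natCast,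
    bernsteinPolynomial, Polynomial.eval_one, nsmul_eq_mul] at h
  have h2 : (4 * 2 ^ N : ℝ) * ∑ k ∈ range (N + 1), ((N : ℝ) * (1 / 2) - k) ^ 2 *
      (N.choose k * (1 / 2) ^ k * (1 - 1 / 2) ^ (N - k)) =
      ∑ k ∈ range (N + 1), (N.choose k : ℝ) * ((N : ℝ) - 2 * k) ^ 2 := by
    rw [mul_sum]
    refine sum_congr rfl fun k hk => ?_
    have : (1 / 2 : ℝ) ^ k * (1 - 1 / 2) ^ (N - k) = (2 ^ N)⁻¹ := by
      rw [show (1 - 1 / 2 : ℝ) = 1 / 2 by norm_num, ← pow_add,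
        Nat.add_sub_cancel' (Nat.lt_succ_iff.mp (mem_range.mp hk))]
      simp
    rw [mul_assoc (N.choose k : ℝ), this]
    field_simp
    ring
  rw [← h2, h]
  ring

theorem sum_choose_mul_abs_le (N : ℕ) :
    ∑ k ∈ range (N + 1), (N.choose k : ℝ) * |(N : ℝ) - 2 * k| ≤ 2 ^ N * √N := by
  rcases N.eq_zero_or_pos with rfl | hN
  · simp
  have hs : 0 < √(N : ℝ) := Real.sqrt_pos.mpr (by exact_mod_cast hN)
  have hss : √(N : ℝ) * √N = N := Real.mul_self_sqrt (by positivity)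
  have key : ∀ k ∈ range (N + 1), 2 * √(N : ℝ) * ((N.choose k : ℝ) * |(N : ℝ) - 2 * k|) ≤
      (N.choose k : ℝ) * ((N : ℝ) - 2 * k) ^ 2 + N * (N.choose k : ℝ) := by
    intro k _
    have h0 : (0 : ℝ) ≤ N.choose k := by positivity
    have h1 := mul_nonneg h0 (sq_nonneg (|(N : ℝ) - 2 * k| - √N))
    have h2 := sq_abs ((N : ℝ) - 2 * k)
    nlinarith
  have h := sum_le_sum key
  rw [← mul_sum, sum_add_distrib, sum_choose_mul_sq, ← mul_sum] at h
  have h3 : ∑ k ∈ range (N + 1), (N.choose k : ℝ) = 2 ^ N := by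
    exact_mod_cast Nat.sum_range_choose N
  rw [h3] at h
  refine le_of_mul_le_mul_left (h.trans (le_of_eq ?_)) (by positivity : 0 < 2 * √(N : ℝ))
  linear_combination (-2 * 2 ^ N : ℝ) * hss

theorem norm_one_add_pow_mul_one_sub_le {A : Type*} [NormedRing A] [NormedAlgebra ℝ A] (T : A)
    {C : ℝ} (hT : ∀ k, ‖T ^ k‖ ≤ C) (n : ℕ) :
    ‖(1 + T) ^ n * (1 - T)‖ ≤ C * (2 ^ (n + 1) / √((n : ℝ) + 1)) := by
  have hid : (1 + T) ^ n * (1 - T) =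
      ∑ k ∈ range (n + 2), (((n + 1).choose k : ℝ) * ((n + 1 : ℝ) - 2 * k) / (n + 1)) • T ^ k := by
    have h1 : (1 + T) ^ n = ∑ k ∈ range (n + 1), (n.choose k : ℝ) • T ^ k := by
      rw [add_comm, (Commute.one_right T).add_pow]
      refine sum_congr rfl fun k _ => ?_
      simp [Algebra.smul_def, Nat.cast_comm]
    have h2 : (1 + T) ^ n * (1 - T) =
        ∑ k ∈ range (n + 2), (n.choose k : ℝ) • T ^ k -
          ∑ k ∈ range (n + 1), (n.choose k : ℝ) • T ^ (k + 1) := by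
      rw [sum_range_succ _ (n + 1), Nat.choose_succ_self, mul_sub, mul_one, h1, sum_mul]
      simp [pow_succ]
    rw [h2, sum_range_succ', sum_range_succ' _ (n + 1), add_sub_right_comm, ← sum_sub_distrib]
    congr 1
    · refine sum_congr rfl fun k _ => ?_
      rw [← sub_smul]
      congr 1
      have e1 : ((n : ℝ) + 1) * n.choose k = (n + 1).choose (k + 1) * (k + 1) := by
        exact_mod_cast Nat.add_one_mul_choose_eq n k
      have e2 : ((n + 1).choose (k + 1) : ℝ) = n.choose k + n.choose (k + 1) := by
        exact_mod_cast Nat.choose_succ_succ n k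
      field_simp
      push_cast
      linear_combination (-2) * e1 - (n + 1 : ℝ) * e2
    · have : (n : ℝ) + 1 ≠ 0 := by positivity
      simp [this]
  rw [hid]
  have hn : (0 : ℝ) < n + 1 := by positivity
  have hC : 0 ≤ C := (norm_nonneg _).trans (hT 0)
  calc _ ≤ ∑ k ∈ range (n + 2), ((n + 1).choose k : ℝ) * |(n + 1 : ℝ) - 2 * k| / (n + 1) * C := by
        refine norm_sum_le_of_le _ fun k _ => ?_
        rw [norm_smul, Real.norm_eq_abs, abs_div, abs_mul, abs_of_pos hn, Nat.abs_cast]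
        gcongr
        exact hT k
    _ ≤ 2 ^ (n + 1) * √((n + 1 : ℕ) : ℝ) / (n + 1) * C := by
        rw [← sum_mul, ← sum_div]
        gcongr
        exact_mod_cast sum_choose_mul_abs_le (n + 1)
    _ = _ := by
        push_cast
        have hs : √((n : ℝ) + 1) ≠ 0 := by positivity
        have hss : √((n : ℝ) + 1) * √(n + 1) = n + 1 := Real.mul_self_sqrt hn.le
        field_simp
        linear_combination C * hss

theorem tendsto_half_one_add_pow_mul_one_sub {A : Type*} [NormedRing A] [NormedAlgebra ℝ A] (T : A)
    {C : ℝ} (hT : ∀ k, ‖T ^ k‖ ≤ C) :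
    Tendsto (fun n : ℕ => ((1 / 2 : ℝ) • (1 + T)) ^ n * (1 - T)) atTop (𝓝 0) := by
  have hlim : Tendsto (fun n : ℕ => C * (2 / √((n : ℝ) + 1))) atTop (𝓝 0) := by
    rw [← mul_zero C]
    refine Tendsto.const_mul C (Tendsto.div_atTop tendsto_const_nhds ?_)
    exact Real.tendsto_sqrt_atTop.comp
      (tendsto_atTop_add_const_right _ _ tendsto_natCast_atTop_atTop)
  refine squeeze_zero_norm (fun n => ?_) hlim
  rw [smul_pow, smul_mul_assoc, norm_smul, norm_pow]
  calc _ ≤ ‖(1 / 2 : ℝ)‖ ^ n * (C * (2 ^ (n + 1) / √((n : ℝ) + 1))) := by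
        gcongr
        exact norm_one_add_pow_mul_one_sub_le T hT n
    _ = _ := by
        rw [Real.norm_eq_abs, abs_of_pos (by norm_num), pow_succ, one_div, inv_pow]
        field_simp

theorem LinearMap.exists_comp_comp_eq_self {K V W : Type*} [Field K] [AddCommGroup V] [Module K V]
    [AddCommGroup W] [Module K W] (f : V →ₗ[K] W) :
    ∃ g : W →ₗ[K] V, f ∘ₗ g ∘ₗ f = f := by
  obtain ⟨g, hg⟩ := f.rangeRestrict.exists_rightInverse_of_surjective f.range_rangeRestrict
  obtain ⟨q, hq⟩ := f.range.subtype.exists_leftInverse_of_injective f.range.ker_subtype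
  refine ⟨g ∘ₗ q, LinearMap.ext fun x => ?_⟩
  have h1 : q (f x) = f.rangeRestrict x := LinearMap.congr_fun hq (f.rangeRestrict x)
  have h2 := LinearMap.congr_fun hg (f.rangeRestrict x)
  simpa [h1] using congrArg Subtype.val h2

/-- averaging a power bounded operator `T` with the identity contracts a seminorm vanishing exactly
on the fixed vectors of `T` -/
theorem exists_contracted_seminorm {E : Type*} [NormedAddCommGroup E] [NormedSpace ℝ E]
    [FiniteDimensional ℝ E] (T : E →L[ℝ] E) {C : ℝ} (hT : ∀ k, ‖T ^ k‖ ≤ C) :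
    ∃ (L : Seminorm ℝ E) (κ B : ℝ), 0 < κ ∧ (∀ z, ‖z - T z‖ ≤ L z) ∧ (∀ z, L z ≤ B * ‖z‖) ∧
      ∀ z, L ((1 / 2 : ℝ) • (z + T z)) ≤ (1 - κ) * L z := by
  set P : E →L[ℝ] E := (1 / 2 : ℝ) • (1 + T) with hP
  set Q : E →L[ℝ] E := 1 - T with hQ
  have hPQ : Commute P Q := by
    have : Commute T Q := (Commute.one_right T).sub_right (Commute.refl T)
    exact ((Commute.one_left Q).add_left this).smul_left _
  obtain ⟨g, hg⟩ := (Q : E →ₗ[ℝ] E).exists_comp_comp_eq_self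
  set G : E →L[ℝ] E := LinearMap.toContinuousLinearMap g
  have hG : Q * G * Q = Q := by
    ext x
    exact LinearMap.congr_fun hg x
  have hlim : Tendsto (fun n : ℕ => P ^ n * Q * G) atTop (𝓝 0) := by
    rw [← zero_mul G]
    exact (tendsto_half_one_add_pow_mul_one_sub T hT).mul_const G
  obtain ⟨J, hJ⟩ := (Metric.tendsto_nhds.mp hlim (1 / 2) (by norm_num)).exists
  rw [dist_zero_right] at hJ
  let a : ℕ → Seminorm ℝ E := fun j => (normSeminorm ℝ E).comp ((P ^ j * Q : E →L[ℝ] E) : E →ₗ[ℝ] E)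
  have ha : ∀ j z, a j z = ‖(P ^ j * Q) z‖ := fun j z => rfl
  have haJ : ∀ z, a J z ≤ 1 / 2 * a 0 z := by
    intro z
    rw [ha, ha, pow_zero, one_mul]
    have : P ^ J * Q = P ^ J * Q * G * Q := by simp only [mul_assoc] at hG ⊢; rw [hG]
    rw [this]
    exact ((P ^ J * Q * G).le_opNorm (Q z)).trans (by gcongr)
  have hshift : ∀ j z, a j (P z) = a (j + 1) z := by
    intro j z
    rw [ha, ha, pow_succ, mul_assoc, hPQ.eq, ← mul_assoc]
    rfl
  set S : ℝ := ∑ j ∈ range J, ‖P ^ j‖ with hS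
  have hS0 : 0 ≤ S := sum_nonneg fun _ _ => norm_nonneg _
  let L : Seminorm ℝ E := ∑ j ∈ range J, a j
  have hL : ∀ z, L z = ∑ j ∈ range J, a j z := by
    intro z
    simp only [L, ← FunLike.coeAddMonoidHom_apply, map_sum, Finset.sum_apply]
  have ha0 : ∀ j z, 0 ≤ a j z := fun j z => apply_nonneg _ _
  have haP : ∀ j z, a j z ≤ ‖P ^ j‖ * a 0 z := by
    intro j z
    rw [ha, ha, pow_zero, one_mul]
    exact (P ^ j).le_opNorm (Q z)
  have hLS : ∀ z, L z ≤ (S + 1) * a 0 z := by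
    intro z
    rw [hL, add_mul, hS, sum_mul]
    linarith [ha0 0 z, sum_le_sum fun j (_ : j ∈ range J) => haP j z]
  have hLP : ∀ z, L (P z) ≤ L z - 1 / 2 * a 0 z := by
    intro z
    have : L (P z) = L z + (a J z - a 0 z) := by
      rw [hL, hL, ← sum_range_sub (fun j => a j z), ← sum_add_distrib]
      refine sum_congr rfl fun j _ => ?_
      rw [hshift]; ring
    linarith [haJ z]
  refine ⟨L, 1 / (2 * (S + 1)), (S + 1) * ‖Q‖, by positivity, fun z => ?_, fun z => ?_, fun z => ?_⟩
  · change a 0 z ≤ L z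
    rcases J.eq_zero_or_pos with rfl | hJ0
    · linarith [haJ z, ha0 0 z, apply_nonneg L z]
    · rw [hL]
      exact single_le_sum (fun j _ => ha0 j z) (mem_range.mpr hJ0)
  · rw [mul_assoc]
    exact (hLS z).trans (by gcongr; exact Q.le_opNorm z)
  · have h1 : L z / (2 * (S + 1)) ≤ 1 / 2 * a 0 z := by
      rw [div_le_iff₀ (by positivity)]
      linarith [hLS z]
    have h2 : (1 - 1 / (2 * (S + 1))) * L z = L z - L z / (2 * (S + 1)) := by ring
    rw [h2]
    exact (hLP z).trans (by linarith)
namespace Urn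

theorem tendsto_zero_of_le_one_sub_div_mul {b δ : ℕ → ℝ} {a : ℝ} (ha : 0 < a)
    (hb : ∀ n, 0 ≤ b n) (hδ : Tendsto δ atTop (𝓝 0))
    (h : ∀ᶠ n : ℕ in atTop, b (n + 1) ≤ (1 - a / (n + 1)) * b n + δ n / (n + 1)) :
    Tendsto b atTop (𝓝 0) := by
  refine tendsto_order.2 ⟨fun x hx => .of_forall fun n => hx.trans_le (hb n), fun x hx => ?_⟩
  set t : ℕ → ℝ := fun n => max (b n - x / 2) 0 with ht
  set S : ℕ → ℝ := fun n => ∑ k ∈ range n, 1 / ((k : ℝ) + 1) with hS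
  have hlarge : ∀ᶠ n : ℕ in atTop, a ≤ (n : ℝ) + 1 :=
    (tendsto_atTop_add_const_right _ _ tendsto_natCast_atTop_atTop).eventually_ge_atTop a
  have hδs : ∀ᶠ n in atTop, δ n < a * (x / 2) := hδ.eventually_lt_const (by positivity)
  obtain ⟨n₀, hn₀⟩ := eventually_atTop.1 (h.and (hlarge.and hδs))
  have hstep : ∀ n, n₀ ≤ n → t (n + 1) * Real.exp (a * S (n + 1)) ≤ t n * Real.exp (a * S n) := by
    intro n hn
    obtain ⟨h1, h2, h3⟩ := hn₀ n hn
    have hp : (0 : ℝ) < n + 1 := by positivity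
    have h4 : 0 ≤ 1 - a / ((n : ℝ) + 1) := by
      rw [sub_nonneg, div_le_one hp]; exact h2
    have h5 : t (n + 1) ≤ (1 - a / (n + 1)) * t n := by
      refine max_le ?_ (mul_nonneg h4 (le_max_right _ _))
      have h6 : b n - x / 2 ≤ t n := le_max_left _ _
      have h7 : δ n / (n + 1) ≤ a * (x / 2) / (n + 1) := by gcongr
      have h8 := mul_le_mul_of_nonneg_left h6 h4
      have h9 : a * (x / 2) / ((n : ℝ) + 1) = a / (n + 1) * (x / 2) := by ring
      linarith
    have h6 : 1 - a / ((n : ℝ) + 1) ≤ Real.exp (-(a / (n + 1))) := by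
      linarith [Real.add_one_le_exp (-(a / ((n : ℝ) + 1)))]
    have h7 : a * S (n + 1) = a * S n + a / (n + 1) := by
      simp only [hS, sum_range_succ]; ring
    calc t (n + 1) * Real.exp (a * S (n + 1))
        ≤ (Real.exp (-(a / (n + 1))) * t n) * Real.exp (a * S (n + 1)) := by
          gcongr
          exact h5.trans (mul_le_mul_of_nonneg_right h6 (le_max_right _ _))
      _ = t n * (Real.exp (-(a / (n + 1))) * Real.exp (a * S (n + 1))) := by ring
      _ = _ := by rw [← Real.exp_add, h7]; congr 2; ring
  have hbound : ∀ n, n₀ ≤ n → t n * Real.exp (a * S n) ≤ t n₀ * Real.exp (a * S n₀) := by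
    intro n hn
    induction n, hn using Nat.le_induction with
    | base => rfl
    | succ n hn ih => exact (hstep n hn).trans ih
  have hSlim : Tendsto (fun n => a * S n) atTop atTop :=
    Real.tendsto_sum_range_one_div_nat_succ_atTop.const_mul_atTop ha
  have hKlim : Tendsto (fun n => t n₀ * Real.exp (a * S n₀) * Real.exp (-(a * S n))) atTop (𝓝 0) := by
    rw [← mul_zero (t n₀ * Real.exp (a * S n₀))]
    exact (Real.tendsto_exp_neg_atTop_nhds_zero.comp hSlim).const_mul _
  filter_upwards [hKlim.eventually_lt_const (half_pos hx), eventually_ge_atTop n₀] with n hn hn'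
  have h1 : t n ≤ t n₀ * Real.exp (a * S n₀) * Real.exp (-(a * S n)) := by
    rw [Real.exp_neg, ← div_eq_mul_inv, le_div_iff₀ (Real.exp_pos _)]
    exact hbound n hn'
  have h2 : b n - x / 2 ≤ t n := le_max_left _ _
  linarith

variable {d : ℕ}

/-- `rmul` by a fixed matrix as a continuous linear map -/
def rmulCLM (A : Fin d → Fin d → ℝ) : (Fin d → ℝ) →L[ℝ] (Fin d → ℝ) :=
  LinearMap.toContinuousLinearMap (Matrix.vecMulLinear (Matrix.of A))

theorem rmulCLM_apply (A : Fin d → Fin d → ℝ) (x : Fin d → ℝ) : rmulCLM A x = rmul x A := rfl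

theorem sum_rmul_mul {H : Fin d → Fin d → ℝ} {u : Fin d → ℝ} {l : ℝ} (hu : cmul H u = l • u)
    (z : Fin d → ℝ) : ∑ q, rmul z H q * u q = l * ∑ k, z k * u k := by
  simp only [rmul, sum_mul]
  rw [sum_comm, mul_sum]
  refine sum_congr rfl fun k _ => ?_
  have := congrFun hu k
  simp only [cmul, Pi.smul_apply, smul_eq_mul] at this
  rw [mul_left_comm, ← this, mul_sum]
  exact sum_congr rfl fun q _ => by ring

theorem norm_rmulCLM_pow_le {R : Fin d → Fin d → ℝ} {u : Fin d → ℝ} (hR : ∀ k q, 0 ≤ R k q)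
    (hu : ∀ k, 0 < u k) (hRu : cmul R u = u) : ∃ C, ∀ k, ‖rmulCLM R ^ k‖ ≤ C := by
  have hcontr : ∀ v, ∑ q, |rmul v R q| * u q ≤ ∑ k, |v k| * u k := by
    intro v
    have h1 := sum_rmul_mul (l := 1) (by rw [hRu, one_smul]) (fun k => |v k|)
    rw [one_mul] at h1
    rw [← h1]
    refine sum_le_sum fun q _ => mul_le_mul_of_nonneg_right ?_ (hu q).le
    refine (abs_sum_le_sum_abs _ _).trans (le_of_eq (sum_congr rfl fun k _ => ?_))
    rw [abs_mul, abs_of_nonneg (hR k q)]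
  have hpow : ∀ n v, ∑ q, |(rmulCLM R ^ n) v q| * u q ≤ ∑ k, |v k| * u k := by
    intro n
    induction n with
    | zero => intro v; rfl
    | succ n ih => intro v; rw [pow_succ]; exact (ih _).trans (hcontr v)
  refine ⟨∑ q, (u q)⁻¹ * ∑ k, u k, fun n => ContinuousLinearMap.opNorm_le_bound _ ?_ fun v => ?_⟩
  · exact sum_nonneg fun q _ => mul_nonneg (inv_nonneg.2 (hu q).le) (sum_nonneg fun k _ => (hu k).le)
  have hU : 0 ≤ ∑ k, u k := sum_nonneg fun k _ => (hu k).le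
  refine (pi_norm_le_iff_of_nonneg ?_).2 fun q => ?_
  · exact mul_nonneg (sum_nonneg fun q _ => mul_nonneg (inv_nonneg.2 (hu q).le) hU) (norm_nonneg _)
  have h1 : |(rmulCLM R ^ n) v q| * u q ≤ (∑ k, u k) * ‖v‖ := by
    calc _ ≤ ∑ q, |(rmulCLM R ^ n) v q| * u q :=
          single_le_sum (f := fun q => |(rmulCLM R ^ n) v q| * u q)
            (fun q _ => mul_nonneg (abs_nonneg _) (hu q).le) (mem_univ q)
      _ ≤ ∑ k, |v k| * u k := hpow n v
      _ ≤ ∑ k, u k * ‖v‖ := sum_le_sum fun k _ => by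
          rw [mul_comm]
          exact mul_le_mul_of_nonneg_left (norm_le_pi_norm v k) (hu k).le
      _ = _ := (sum_mul ..).symm
  calc ‖(rmulCLM R ^ n) v q‖ = (u q)⁻¹ * (|(rmulCLM R ^ n) v q| * u q) := by
        rw [Real.norm_eq_abs]
        field_simp [(hu q).ne']
    _ ≤ (u q)⁻¹ * ((∑ k, u k) * ‖v‖) :=
        mul_le_mul_of_nonneg_left h1 (inv_nonneg.2 (hu q).le)
    _ = (u q)⁻¹ * (∑ k, u k) * ‖v‖ := by ring
    _ ≤ _ := by
        gcongr
        exact single_le_sum (f := fun q => (u q)⁻¹ * ∑ k, u k)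
          (fun q _ => mul_nonneg (inv_nonneg.2 (hu q).le) hU) (mem_univ q)

theorem exists_seminorm_add_smul_rmul_le {H : Fin d → Fin d → ℝ} {u : Fin d → ℝ} {l : ℝ}
    (hH : ∀ q k, q ≠ k → 0 ≤ H q k) (hu : ∀ k, 0 < u k) (hHu : cmul H u = l • u) :
    ∃ (L : Seminorm ℝ (Fin d → ℝ)) (κ B B' r : ℝ), 0 < κ ∧ 0 < r ∧
      (∀ z, ‖rmul z H - l • z‖ ≤ B' * L z) ∧ (∀ z, L z ≤ B * ‖z‖) ∧
      ∀ η z, 0 ≤ η → η ≤ r → L (z + η • rmul z H) ≤ (1 + η * l - κ * η) * L z := by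
  set ε : ℝ := (1 + |l| + ∑ i, |H i i|)⁻¹ with hε
  have hpos : 0 < 1 + |l| + ∑ i, |H i i| := by positivity
  have hε0 : 0 < ε := inv_pos.2 hpos
  set R : Fin d → Fin d → ℝ := fun k q => (if k = q then 1 - ε * l else 0) + ε * H k q with hRdef
  have hR : ∀ k q, 0 ≤ R k q := by
    intro k q
    simp only [hRdef]
    split_ifs with hkq
    · subst hkq
      have h1 : |H k k| ≤ ∑ i, |H i i| :=
        single_le_sum (f := fun i => |H i i|) (fun i _ => abs_nonneg _) (mem_univ k)
      have h2 : ε * (l - H k k) ≤ 1 := by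
        rw [hε, inv_mul_le_iff₀ hpos]
        linarith [le_abs_self l, neg_abs_le (H k k)]
      linarith
    · rw [zero_add]
      exact mul_nonneg hε0.le (hH k q hkq)
  have hT : ∀ z, rmulCLM R z = z + ε • (rmul z H - l • z) := by
    intro z
    ext q
    simp only [rmulCLM_apply, rmul, hRdef, mul_add, sum_add_distrib, Pi.add_apply, Pi.smul_apply,
      Pi.sub_apply, smul_eq_mul, mul_ite, mul_zero, sum_ite_eq', mem_univ, if_true, mul_sub,
      mul_sum]
    have : ∑ k, z k * (ε * H k q) = ∑ k, ε * (z k * H k q) := sum_congr rfl fun k _ => by ring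
    rw [this]
    ring
  have hRu : cmul R u = u := by
    ext q
    have := congrFun hHu q
    simp only [cmul, Pi.smul_apply, smul_eq_mul] at this
    simp only [cmul, hRdef, add_mul, sum_add_distrib, ite_mul, zero_mul, sum_ite_eq, mem_univ,
      if_true, mul_assoc, ← mul_sum, this]
    ring
  obtain ⟨C, hC⟩ := norm_rmulCLM_pow_le hR hu hRu
  obtain ⟨L, κ, B, hκ, h1, h2, h3⟩ := exists_contracted_seminorm (rmulCLM R) hC
  refine ⟨L, 2 * κ / ε, B, ε⁻¹, (|l| + 2 / ε)⁻¹, by positivity, by positivity, fun z => ?_, h2,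
    fun η z hη hηr => ?_⟩
  · have := h1 z
    rw [hT, sub_add_cancel_left, norm_neg, norm_smul, Real.norm_eq_abs, abs_of_pos hε0] at this
    rwa [inv_mul_eq_div, le_div_iff₀' hε0]
  · have hc : 0 ≤ 1 + η * l - 2 * η / ε := by
      have h4 : η * (|l| + 2 / ε) ≤ 1 := (le_div_iff₀ (by positivity)).1 (by rwa [one_div])
      have h5 := mul_le_mul_of_nonneg_left (neg_abs_le l) hη
      have h6 : 2 * η / ε = η * (2 / ε) := by ring
      linarith
    have hz : z + η • rmul z H = (1 + η * l - 2 * η / ε) • z +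
        (2 * η / ε) • ((1 / 2 : ℝ) • (z + rmulCLM R z)) := by
      rw [hT]
      ext q
      simp only [Pi.add_apply, Pi.smul_apply, Pi.sub_apply, smul_eq_mul]
      field_simp
      ring
    have h4 : 0 ≤ 2 * η / ε := by positivity
    rw [hz]
    refine (map_add_le_add L _ _).trans ?_
    rw [map_smul_eq_mul, map_smul_eq_mul, Real.norm_of_nonneg hc, Real.norm_of_nonneg h4]
    have := mul_le_mul_of_nonneg_left (h3 z) h4
    calc _ ≤ (1 + η * l - 2 * η / ε) * L z + 2 * η / ε * ((1 - κ) * L z) := by gcongr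
      _ = _ := by ring

end Urn
namespace Urn

variable {d : ℕ}

theorem exists_mul_sum_le_sum_mul {u : Fin d → ℝ} (hu : ∀ k, 0 < u k) :
    ∃ a b : ℝ, 0 < a ∧ 0 < b ∧ ∀ v : Fin d → ℝ, (∀ k, 0 ≤ v k) →
      a * ∑ k, v k ≤ ∑ k, v k * u k ∧ ∑ k, v k * u k ≤ b * ∑ k, v k := by
  have h1 : 0 ≤ ∑ k, (u k)⁻¹ := sum_nonneg fun k _ => (inv_pos.2 (hu k)).le
  have h2 : 0 ≤ ∑ k, u k := sum_nonneg fun k _ => (hu k).le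
  refine ⟨(∑ k, (u k)⁻¹ + 1)⁻¹, ∑ k, u k + 1, by positivity, by positivity, fun v hv => ⟨?_, ?_⟩⟩
  · rw [mul_sum]
    refine sum_le_sum fun k _ => ?_
    rw [mul_comm]
    refine mul_le_mul_of_nonneg_left (inv_le_of_inv_le₀ (hu k) ?_) (hv k)
    linarith [single_le_sum (f := fun k => (u k)⁻¹) (fun i _ => (inv_pos.2 (hu i)).le) (mem_univ k)]
  · rw [mul_sum]
    refine sum_le_sum fun k _ => ?_
    rw [mul_comm]
    refine mul_le_mul_of_nonneg_right ?_ (hv k)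
    linarith [single_le_sum (f := u) (fun i _ => (hu i).le) (mem_univ k)]

theorem isLittleO_sum_mul {f : ℕ → Fin d → ℝ} (u : Fin d → ℝ) {g : ℕ → ℝ}
    (hf : f =o[atTop] g) : (fun n => ∑ k, f n k * u k) =o[atTop] g := by
  refine IsLittleO.fun_sum fun k _ => ?_
  simpa only [mul_comm] using (isLittleO_pi.1 hf k).const_mul_left (u k)

theorem isLittleO_asum {f : ℕ → Fin d → ℝ} {g : ℕ → ℝ}
    (hf : f =o[atTop] g) : (fun n => asum (f n)) =o[atTop] g := by
  simpa [asum] using isLittleO_sum_mul 1 hf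

theorem isLittleO_natCast_iff {E : Type*} [NormedAddCommGroup E] {f : ℕ → E} :
    f =o[atTop] (fun n : ℕ => (n : ℝ)) ↔
      ∀ ε > (0 : ℝ), ∀ᶠ n : ℕ in atTop, ‖f n‖ ≤ ε * n := by
  simp only [isLittleO_iff, Real.norm_natCast, gt_iff_lt]

theorem isLittleO_max_neg_of_increments {A y : ℕ → ℝ} {K : ℝ}
    (hAy : (fun n => y n - A n) =o[atTop] (fun n : ℕ => (n : ℝ)))
    (hK : ∀ n, A n - K ≤ A (n + 1)) (hmono : ∀ᶠ n in atTop, y n ≤ 0 → A n ≤ A (n + 1)) :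
    (fun n => max (-y n) 0) =o[atTop] (fun n : ℕ => (n : ℝ)) := by
  rw [isLittleO_natCast_iff] at hAy ⊢
  intro ε hε
  set e := ε / 3 with he
  have he0 : 0 < e := by positivity
  obtain ⟨n₀, hn₀⟩ := eventually_atTop.1 ((hAy e he0).and hmono)
  set K' := max K |A n₀| with hK'
  have hK'0 : 0 ≤ K' := (abs_nonneg _).trans (le_max_right _ _)
  have hA : ∀ n, n₀ ≤ n → -(e * n) - K' ≤ A n := by
    intro n hn
    induction n, hn using Nat.le_induction with
    | base =>
      have : |A n₀| ≤ K' := le_max_right _ _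
      have : 0 ≤ e * n₀ := by positivity
      linarith [neg_abs_le (A n₀)]
    | succ n hn ih =>
      obtain ⟨h1, h2⟩ := hn₀ n hn
      have hKK : K ≤ K' := le_max_left _ _
      push_cast
      rcases le_or_gt (-(e * n)) (A n) with h | h
      · linarith [hK n]
      · have := (abs_le.1 h1).2
        linarith [h2 (by linarith)]
  have hlarge : ∀ᶠ n : ℕ in atTop, K' / e ≤ n := tendsto_natCast_atTop_atTop.eventually_ge_atTop _
  filter_upwards [hlarge, eventually_ge_atTop n₀] with n hn hn'
  have h1 := (abs_le.1 (hn₀ n hn').1).1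
  have h2 := hA n hn'
  rw [div_le_iff₀' he0] at hn
  rw [Real.norm_of_nonneg (le_max_right _ _)]
  refine max_le ?_ (by positivity)
  have h3 : ε * n = 3 * (e * n) := by rw [he]; ring
  linarith

theorem sum_mem_simplex {pr : ℕ → Fin d → ℝ} (hpr : ∀ n, pr n ∈ simplex d) (n : ℕ) :
    (∀ k, 0 ≤ (∑ m ∈ range n, pr m) k) ∧ ∑ k, (∑ m ∈ range n, pr m) k = n := by
  constructor
  · intro k
    rw [Finset.sum_apply]
    exact sum_nonneg fun m _ => (hpr m).1 k
  · simp only [Finset.sum_apply]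
    rw [sum_comm, sum_congr rfl fun m _ => (hpr m).2]
    simp

theorem norm_le_of_sum_eq {v : Fin d → ℝ} {c : ℝ} (hv : ∀ k, 0 ≤ v k) (hs : ∑ k, v k = c) :
    ‖v‖ ≤ c := by
  subst hs
  refine (pi_norm_le_iff_of_nonneg (sum_nonneg fun k _ => hv k)).2 fun k => ?_
  rw [Real.norm_of_nonneg (hv k)]
  exact single_le_sum (fun i _ => hv i) (mem_univ k)

theorem vpos_nonneg (y : Fin d → ℝ) (k : Fin d) : 0 ≤ vpos y k := le_max_right _ _

/-- The deterministic dynamics behind the urn: `Y n` is asymptotically `G n · H` where `G n` is the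
sum of the first `n` draw probabilities `pr m`, and `pr m` is proportional to the positive part
of `Y m`. -/
structure UrnFlow (H : Fin d → Fin d → ℝ) (u : Fin d → ℝ) (l : ℝ) (pr Y : ℕ → Fin d → ℝ) :
    Prop where
  offDiag : ∀ q k, q ≠ k → 0 ≤ H q k
  eigvec_pos : ∀ k, 0 < u k
  eig : cmul H u = l • u
  eig_pos : 0 < l
  mem_simplex : ∀ n, pr n ∈ simplex d
  pr_eq : ∀ n, 0 < asum (vpos (Y n)) → pr n = fun k => vpos (Y n) k / asum (vpos (Y n))
  isLittleO : (fun n => Y n - rmul (∑ m ∈ range n, pr m) H) =o[atTop] (fun n : ℕ => (n : ℝ))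

namespace UrnFlow

variable {H : Fin d → Fin d → ℝ} {u : Fin d → ℝ} {l : ℝ} {pr Y : ℕ → Fin d → ℝ}

theorem asum_vpos_ge (h : UrnFlow H u l pr Y) :
    ∃ c > 0, ∀ᶠ n : ℕ in atTop, c * n ≤ asum (vpos (Y n)) := by
  obtain ⟨a, b, ha, hb, hab⟩ := exists_mul_sum_le_sum_mul h.eigvec_pos
  have hl := h.eig_pos
  refine ⟨a * l / 2 / b, by positivity, ?_⟩
  filter_upwards [isLittleO_natCast_iff.1 (isLittleO_sum_mul u h.isLittleO) (a * l / 2)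
    (by positivity)] with n hn
  simp only [Pi.sub_apply, sub_mul, sum_sub_distrib, sum_rmul_mul h.eig] at hn
  have h1 := (abs_le.1 hn).1
  obtain ⟨h2, h3⟩ := sum_mem_simplex h.mem_simplex n
  have h4 := (hab _ h2).1
  rw [h3] at h4
  have h5 := mul_le_mul_of_nonneg_left h4 hl.le
  have h6 := (hab _ (vpos_nonneg (Y n))).2
  have h7 : ∑ k, Y n k * u k ≤ ∑ k, vpos (Y n) k * u k :=
    sum_le_sum fun k _ => mul_le_mul_of_nonneg_right (le_max_left _ _) (h.eigvec_pos k).le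
  rw [div_mul_eq_mul_div, div_le_iff₀ hb, asum]
  linarith

theorem eventually_asum_vpos_pos (h : UrnFlow H u l pr Y) :
    ∀ᶠ n in atTop, 0 < asum (vpos (Y n)) := by
  obtain ⟨c, hc, hcn⟩ := h.asum_vpos_ge
  filter_upwards [hcn, eventually_gt_atTop 0] with n hn hn0
  have : (0 : ℝ) < n := by exact_mod_cast hn0
  exact (by positivity : 0 < c * n).trans_le hn

theorem vpos_sub_isLittleO (h : UrnFlow H u l pr Y) :
    (fun n => vpos (Y n) - Y n) =o[atTop] (fun n : ℕ => (n : ℝ)) := by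
  refine isLittleO_pi.2 fun q => ?_
  have heq : (fun n => (vpos (Y n) - Y n) q) = fun n => max (-Y n q) 0 := by
    funext n
    simp only [vpos, Pi.sub_apply]
    rcases le_total (Y n q) 0 with h0 | h0
    · rw [max_eq_right h0, max_eq_left (by linarith)]; ring
    · rw [max_eq_left h0, max_eq_right (by linarith)]; ring
  rw [heq]
  have hinc : ∀ n, rmul (∑ m ∈ range (n + 1), pr m) H q =
      rmul (∑ m ∈ range n, pr m) H q + rmul (pr n) H q := by
    intro n
    rw [sum_range_succ, ← rmulCLM_apply, map_add]
    rfl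
  refine isLittleO_max_neg_of_increments (K := ‖rmulCLM H‖) (isLittleO_pi.1 h.isLittleO q) ?_ ?_
  · intro n
    rw [hinc]
    have h1 : |rmul (pr n) H q| ≤ ‖rmulCLM H‖ :=
      (norm_le_pi_norm (rmulCLM H (pr n)) q).trans
        ((rmulCLM H).unit_le_opNorm _ (norm_le_of_sum_eq (h.mem_simplex n).1 (h.mem_simplex n).2))
    linarith [(abs_le.1 h1).1]
  · filter_upwards [h.eventually_asum_vpos_pos] with n hn hY
    rw [hinc]
    refine le_add_of_nonneg_right (sum_nonneg fun k _ => ?_)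
    rcases eq_or_ne k q with rfl | hkq
    · have : pr n k = 0 := by
        rw [h.pr_eq n hn]
        simp [vpos, max_eq_right hY]
      rw [this, zero_mul]
    · exact mul_nonneg ((h.mem_simplex n).1 k) (h.offDiag k q hkq)

theorem vpos_sub_rmul_isLittleO (h : UrnFlow H u l pr Y) :
    (fun n => vpos (Y n) - rmul (∑ m ∈ range n, pr m) H) =o[atTop] (fun n : ℕ => (n : ℝ)) := by
  simpa using h.vpos_sub_isLittleO.add h.isLittleO

theorem norm_sum_le (h : UrnFlow H u l pr Y) (n : ℕ) : ‖∑ m ∈ range n, pr m‖ ≤ n :=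
  norm_le_of_sum_eq (sum_mem_simplex h.mem_simplex n).1 (sum_mem_simplex h.mem_simplex n).2

theorem asum_vpos_le (h : UrnFlow H u l pr Y) :
    ∃ C > 0, ∀ᶠ n : ℕ in atTop, asum (vpos (Y n)) ≤ C * n := by
  refine ⟨d * (1 + ‖rmulCLM H‖) + 1, by positivity, ?_⟩
  filter_upwards [isLittleO_natCast_iff.1 h.vpos_sub_rmul_isLittleO 1 one_pos] with n hn
  have h1 : ‖vpos (Y n)‖ ≤ (1 + ‖rmulCLM H‖) * n := by
    calc _ ≤ ‖vpos (Y n) - rmul (∑ m ∈ range n, pr m) H‖ + ‖rmulCLM H (∑ m ∈ range n, pr m)‖ := by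
          rw [rmulCLM_apply]
          exact norm_le_norm_sub_add _ _
      _ ≤ 1 * n + ‖rmulCLM H‖ * n := by
          gcongr
          exact (rmulCLM H).le_opNorm_of_le (h.norm_sum_le n)
      _ = _ := by ring
  calc asum (vpos (Y n)) ≤ ∑ _k : Fin d, ‖vpos (Y n)‖ :=
        sum_le_sum fun k _ => (Real.le_norm_self _).trans (norm_le_pi_norm _ k)
    _ = d * ‖vpos (Y n)‖ := by simp
    _ ≤ d * ((1 + ‖rmulCLM H‖) * n) := by gcongr
    _ ≤ _ := by
        have : (0 : ℝ) ≤ n := by positivity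
        linarith

theorem rmul_sub_smul_isLittleO (h : UrnFlow H u l pr Y) :
    (fun n => rmul (∑ m ∈ range n, pr m) H - l • ∑ m ∈ range n, pr m) =o[atTop]
      (fun n : ℕ => (n : ℝ)) := by
  obtain ⟨L, κ, B, B', r, hκ, hr, hLB', hLB, hL⟩ :=
    exists_seminorm_add_smul_rmul_le h.offDiag h.eigvec_pos h.eig
  obtain ⟨a, b, ha, hb, hab⟩ := exists_mul_sum_le_sum_mul h.eigvec_pos
  obtain ⟨c, hc, hcn⟩ := h.asum_vpos_ge
  obtain ⟨C, hC, hCn⟩ := h.asum_vpos_le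
  set G : ℕ → Fin d → ℝ := fun n => ∑ m ∈ range n, pr m with hG
  set s : ℕ → ℝ := fun n => asum (vpos (Y n)) with hs
  set w : ℕ → ℝ := fun n => ∑ k, G n k * u k with hw
  set e : ℕ → Fin d → ℝ := fun n => (s n)⁻¹ • (vpos (Y n) - rmul (G n) H) with he
  have hw1 : ∀ n, a * n ≤ w n := fun n => by
    have := (hab _ (sum_mem_simplex h.mem_simplex n).1).1
    rwa [(sum_mem_simplex h.mem_simplex n).2] at this
  have hw2 : ∀ n, w n ≤ b * n := fun n => by
    have := (hab _ (sum_mem_simplex h.mem_simplex n).1).2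
    rwa [(sum_mem_simplex h.mem_simplex n).2] at this
  have he0 : Tendsto e atTop (𝓝 0) := by
    refine (isLittleO_one_iff ℝ).1 ?_
    have h1 : (fun n => (s n)⁻¹) =O[atTop] (fun n : ℕ => ((n : ℝ))⁻¹) := by
      refine IsBigO.of_bound c⁻¹ ?_
      filter_upwards [hcn, eventually_gt_atTop 0] with n hn hn0
      have hn0' : (0 : ℝ) < n := by exact_mod_cast hn0
      have h2 : 0 < c * n := by positivity
      rw [Real.norm_of_nonneg (inv_nonneg.2 (h2.le.trans hn)), Real.norm_of_nonneg (by positivity),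
        ← mul_inv]
      exact inv_anti₀ h2 hn
    refine (h1.smul_isLittleO h.vpos_sub_rmul_isLittleO).congr' .rfl ?_
    filter_upwards [eventually_gt_atTop 0] with n hn0
    have hn0' : (0 : ℝ) < n := by exact_mod_cast hn0
    simp [hn0'.ne']
  have hrec : ∀ n, 0 < s n → G (n + 1) = G n + (s n)⁻¹ • rmul (G n) H + e n := by
    intro n hn
    have h1 : pr n = (s n)⁻¹ • vpos (Y n) := by
      rw [h.pr_eq n hn]
      funext k
      simp [hs, div_eq_inv_mul]
    have h2 : G (n + 1) = G n + pr n := sum_range_succ _ _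
    rw [h2, h1, he]
    simp only [smul_sub]
    abel
  set δ : ℕ → ℝ := fun n => (B * ‖e n‖ - (∑ k, e n k * u k) * (L (G n) / w n)) / a with hδ
  have hbnd : ∀ n, L (G n) / w n ≤ |B| / a := by
    intro n
    rcases n.eq_zero_or_pos with rfl | hn0
    · simp only [hG, range_zero, sum_empty, map_zero, zero_div]
      positivity
    · have hn0' : (0 : ℝ) < n := by exact_mod_cast hn0
      have h1 : 0 < a * n := by positivity
      rw [div_le_div_iff₀ (h1.trans_le (hw1 n)) ha]
      calc L (G n) * a ≤ |B| * n * a := by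
            gcongr
            refine (hLB _).trans ?_
            calc B * ‖G n‖ ≤ |B| * ‖G n‖ := by gcongr; exact le_abs_self B
              _ ≤ _ := by gcongr; exact h.norm_sum_le n
        _ = |B| * (a * n) := by ring
        _ ≤ _ := by gcongr; exact hw1 n
  have hw0 : ∀ n, 0 ≤ w n := fun n => (by positivity : 0 ≤ a * n).trans (hw1 n)
  have hb0 : ∀ n, 0 ≤ L (G n) / w n := fun n => div_nonneg (apply_nonneg L _) (hw0 n)
  have hδ0 : Tendsto δ atTop (𝓝 0) := by
    have h1 : Tendsto (fun n => B * ‖e n‖) atTop (𝓝 0) := by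
      simpa using he0.norm.const_mul B
    have h2 : Tendsto (fun n => ∑ k, e n k * u k) atTop (𝓝 0) := by
      have := tendsto_finsetSum univ fun k _ => ((tendsto_pi_nhds.1 he0 k).mul_const (u k))
      simpa using this
    have h3 : Tendsto (fun n => (∑ k, e n k * u k) * (L (G n) / w n)) atTop (𝓝 0) := by
      refine h2.zero_mul_isBoundedUnder_le ?_
      refine isBoundedUnder_of ⟨|B| / a, fun n => ?_⟩
      simp only [Function.comp, Real.norm_of_nonneg (hb0 n)]
      exact hbnd n
    simpa using (h1.sub h3).div_const a
  have hδabs : Tendsto (fun n => |δ n|) atTop (𝓝 0) := by simpa using hδ0.abs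
  have hblim : Tendsto (fun n => L (G n) / w n) atTop (𝓝 0) := by
    refine tendsto_zero_of_le_one_sub_div_mul (a := κ * a / (C * b)) (by positivity) hb0 hδabs ?_
    have hrs : ∀ᶠ n : ℕ in atTop, r⁻¹ ≤ c * n :=
      (tendsto_natCast_atTop_atTop.const_mul_atTop hc).eventually_ge_atTop _
    filter_upwards [hcn, hCn, hrs, eventually_gt_atTop 0] with n hn1 hn2 hn3 hn0
    have hn0' : (0 : ℝ) < n := by exact_mod_cast hn0
    have hsn : 0 < s n := (by positivity : 0 < c * (n : ℝ)).trans_le hn1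
    have hwn : 0 < w n := (by positivity : 0 < a * (n : ℝ)).trans_le (hw1 n)
    have hwn1 : a * ((n : ℝ) + 1) ≤ w (n + 1) := by exact_mod_cast hw1 (n + 1)
    have hwn2 : w (n + 1) ≤ b * ((n : ℝ) + 1) := by exact_mod_cast hw2 (n + 1)
    have hwn1' : 0 < w (n + 1) := (by positivity : 0 < a * ((n : ℝ) + 1)).trans_le hwn1
    set η := (s n)⁻¹ with hη
    have hη0 : 0 < η := inv_pos.2 hsn
    have hηr : η ≤ r := inv_le_of_inv_le₀ hr (hn3.trans hn1)
    have hLn : L (G (n + 1)) ≤ (1 + η * l - κ * η) * L (G n) + B * ‖e n‖ := by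
      rw [hrec n hsn]
      exact (map_add_le_add L _ _).trans (add_le_add (hL η _ hη0.le hηr) (hLB _))
    have hwrec : w (n + 1) = (1 + η * l) * w n + ∑ k, e n k * u k := by
      simp only [hw]
      rw [hrec n hsn]
      simp only [Pi.add_apply, Pi.smul_apply, smul_eq_mul, add_mul, sum_add_distrib, mul_assoc,
        ← mul_sum]
      rw [sum_rmul_mul h.eig]
      ring
    have hLw : L (G n) = w n * (L (G n) / w n) := by field_simp
    set β := L (G n) / w n with hβ
    have hβ0 : 0 ≤ β := hb0 n
    have hκη : κ * a / (C * b) / (n + 1) ≤ κ * η * w n / w (n + 1) := by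
      have h1 : (C * n)⁻¹ ≤ η := inv_anti₀ hsn hn2
      calc κ * a / (C * b) / (n + 1) = κ * (C * n)⁻¹ * (a * n) / (b * (n + 1)) := by
            field_simp
        _ ≤ κ * η * w n / w (n + 1) := by
            gcongr
            exact hw1 n
    have hδn : (B * ‖e n‖ - (∑ k, e n k * u k) * β) / w (n + 1) ≤ |δ n| / (n + 1) := by
      have h1 : B * ‖e n‖ - (∑ k, e n k * u k) * β = a * δ n := by
        change _ = a * ((B * ‖e n‖ - (∑ k, e n k * u k) * β) / a)
        exact ((mul_comm _ _).trans (div_mul_cancel₀ _ ha.ne')).symm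
      rw [h1]
      calc a * δ n / w (n + 1) ≤ a * |δ n| / (a * (n + 1)) := by
            gcongr
            exact le_abs_self _
        _ = _ := by field_simp
    calc L (G (n + 1)) / w (n + 1)
        ≤ ((1 + η * l - κ * η) * L (G n) + B * ‖e n‖) / w (n + 1) := by gcongr
      _ = (1 - κ * η * w n / w (n + 1)) * β
            + (B * ‖e n‖ - (∑ k, e n k * u k) * β) / w (n + 1) := by
          rw [hLw]
          field_simp
          rw [hwrec]
          ring
      _ ≤ _ := by gcongr
  have hLo : (fun n => L (G n)) =o[atTop] (fun n : ℕ => (n : ℝ)) := by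
    have h1 : (fun n => L (G n) / w n * w n) =o[atTop] (fun n : ℕ => 1 * (n : ℝ)) := by
      refine ((isLittleO_one_iff ℝ).2 hblim).mul_isBigO (IsBigO.of_bound b ?_)
      refine .of_forall fun n => ?_
      rw [Real.norm_of_nonneg (hw0 n), Real.norm_natCast]
      exact hw2 n
    simp only [one_mul] at h1
    refine h1.congr' ?_ .rfl
    filter_upwards [eventually_gt_atTop 0] with n hn0
    have hn0' : (0 : ℝ) < n := by exact_mod_cast hn0
    have hwn : 0 < w n := (by positivity : 0 < a * (n : ℝ)).trans_le (hw1 n)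
    field_simp
  refine IsBigO.trans_isLittleO (IsBigO.of_bound B' (.of_forall fun n => ?_)) hLo
  rw [Real.norm_of_nonneg (apply_nonneg L _)]
  exact hLB' _

theorem vpos_sub_smul_isLittleO (h : UrnFlow H u l pr Y) :
    (fun n => vpos (Y n) - l • ∑ m ∈ range n, pr m) =o[atTop] (fun n : ℕ => (n : ℝ)) := by
  simpa using h.vpos_sub_rmul_isLittleO.add h.rmul_sub_smul_isLittleO

theorem sub_smul_isLittleO (h : UrnFlow H u l pr Y) :
    (fun n => Y n - l • ∑ m ∈ range n, pr m) =o[atTop] (fun n : ℕ => (n : ℝ)) := by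
  simpa using h.isLittleO.add h.rmul_sub_smul_isLittleO

theorem smul_pr_sub_isLittleO (h : UrnFlow H u l pr Y) :
    (fun n : ℕ => (n : ℝ) • pr n - ∑ m ∈ range n, pr m) =o[atTop] (fun n : ℕ => (n : ℝ)) := by
  have h1 : (fun n : ℕ => asum (vpos (Y n)) - l * n) =o[atTop] (fun n : ℕ => (n : ℝ)) := by
    refine (isLittleO_asum h.vpos_sub_smul_isLittleO).congr_left fun n => ?_
    have := (sum_mem_simplex h.mem_simplex n).2
    simp only [asum, Pi.sub_apply, Pi.smul_apply, smul_eq_mul, sum_sub_distrib, ← mul_sum, this]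
  have h2 : (fun n : ℕ => (asum (vpos (Y n)) - l * n) • pr n) =o[atTop]
      (fun n : ℕ => (n : ℝ)) := by
    have hO : pr =O[atTop] (fun _ => (1 : ℝ)) :=
      IsBigO.of_bound 1 (.of_forall fun n => by
        simpa using norm_le_of_sum_eq (h.mem_simplex n).1 (h.mem_simplex n).2)
    simpa using h1.smul_isBigO hO
  refine ((h.vpos_sub_smul_isLittleO.sub h2).const_smul_left l⁻¹).congr' ?_ .rfl
  filter_upwards [h.eventually_asum_vpos_pos] with n hn
  have h3 : vpos (Y n) = asum (vpos (Y n)) • pr n := by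
    conv_rhs => rw [h.pr_eq n hn]
    funext k
    simp only [Pi.smul_apply, smul_eq_mul]
    field_simp
  have hl := h.eig_pos.ne'
  funext k
  have h4 := congrFun h3 k
  simp only [Pi.smul_apply, Pi.sub_apply, smul_eq_mul] at h4 ⊢
  rw [inv_mul_eq_div, div_eq_iff hl]
  linear_combination h4

end UrnFlow

end Urn
theorem isLittleO_natCast_of_subseq_sq {S : ℕ → ℝ} (hS : ∀ n, |S (n + 1) - S n| ≤ 1)
    (hsq : Tendsto (fun k : ℕ => S (k ^ 2) / (k : ℝ) ^ 2) atTop (𝓝 0)) :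
    S =o[atTop] (fun n : ℕ => (n : ℝ)) := by
  rw [Urn.isLittleO_natCast_iff]
  intro ε hε
  have hinc : ∀ n j, |S (n + j) - S n| ≤ j := by
    intro n j
    induction j with
    | zero => simp
    | succ j ih =>
      have h1 := abs_sub_le (S (n + (j + 1))) (S (n + j)) (S n)
      push_cast
      have h2 : |S (n + (j + 1)) - S (n + j)| ≤ 1 := hS (n + j)
      linarith
  have h1 : ∀ᶠ k : ℕ in atTop, |S (k ^ 2)| ≤ ε / 2 * (k : ℝ) ^ 2 ∧ 4 / ε ≤ k ∧ 0 < k := by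
    filter_upwards [(Metric.tendsto_nhds.1 hsq) (ε / 2) (by positivity),
      tendsto_natCast_atTop_atTop.eventually_ge_atTop (4 / ε), eventually_gt_atTop 0]
      with k hk hk' hk0
    refine ⟨?_, hk', hk0⟩
    have hk0' : (0 : ℝ) < (k : ℝ) ^ 2 := by positivity
    rw [dist_zero_right, Real.norm_eq_abs, abs_div, abs_of_pos hk0', div_lt_iff₀ hk0'] at hk
    exact hk.le
  have hsqrt : Tendsto Nat.sqrt atTop atTop :=
    tendsto_atTop.2 fun b => (eventually_ge_atTop (b * b)).mono fun n hn => Nat.le_sqrt.2 hn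
  filter_upwards [hsqrt.eventually h1] with n hn
  obtain ⟨h2, h3, h4⟩ := hn
  set k := n.sqrt
  have h5 : k ^ 2 ≤ n := Nat.sqrt_le' n
  have h6 : n ≤ k ^ 2 + 2 * k := by
    have : n ≤ k * k + k + k := Nat.sqrt_le_add n
    rw [pow_two]
    omega
  obtain ⟨j, hj⟩ := Nat.exists_eq_add_of_le h5
  have h7 := hinc (k ^ 2) j
  rw [← hj] at h7
  have h8 : (j : ℝ) ≤ 2 * k := by exact_mod_cast (by omega : j ≤ 2 * k)
  have h9 : ((k : ℝ)) ^ 2 ≤ n := by exact_mod_cast h5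
  have h10 : 4 ≤ ε * k := by rwa [div_le_iff₀' hε] at h3
  have h11 : 2 * (k : ℝ) ≤ ε / 2 * (k : ℝ) ^ 2 := by
    have : (0 : ℝ) < k := by exact_mod_cast h4
    nlinarith
  have h12 := abs_sub_abs_le_abs_sub (S n) (S (k ^ 2))
  rw [Real.norm_eq_abs]
  nlinarith

/-- strong law of large numbers for the martingale with increments `ξ n - μ[ξ n | ℱ n]`,
where `ξ n` takes values in `[0, 1]` -/
theorem ae_sum_sub_condExp_isLittleO {Ω : Type*} {m0 : MeasurableSpace Ω} (μ : Measure Ω)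
    [IsProbabilityMeasure μ] (ℱ : Filtration ℕ m0) {ξ : ℕ → Ω → ℝ}
    (hm : ∀ n, StronglyMeasurable[ℱ (n + 1)] (ξ n)) (h0 : ∀ n ω, 0 ≤ ξ n ω)
    (h1 : ∀ n ω, ξ n ω ≤ 1) :
    ∀ᵐ ω ∂μ, (fun n => ∑ m ∈ range n, (ξ m ω - (μ[ξ m | ℱ m]) ω)) =o[atTop]
      (fun n : ℕ => (n : ℝ)) := by
  set Δ : ℕ → Ω → ℝ := fun m => ξ m - μ[ξ m | ℱ m] with hΔ
  set S : ℕ → Ω → ℝ := fun n => ∑ m ∈ range n, Δ m with hS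
  have hξint : ∀ n, Integrable (ξ n) μ := fun n =>
    Integrable.of_bound ((hm n).mono (ℱ.le _)).aestronglyMeasurable 1
      (.of_forall fun ω => by rw [Real.norm_of_nonneg (h0 n ω)]; exact h1 n ω)
  have hΔm : ∀ n, StronglyMeasurable[ℱ (n + 1)] (Δ n) := fun n =>
    (hm n).sub (stronglyMeasurable_condExp.mono (ℱ.mono n.le_succ))
  have hΔb : ∀ n, ∀ᵐ ω ∂μ, |Δ n ω| ≤ 1 := by
    intro n
    have e0 : 0 ≤ᵐ[μ] μ[ξ n | ℱ n] := condExp_nonneg (.of_forall (h0 n))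
    have e1 : μ[ξ n | ℱ n] ≤ᵐ[μ] μ[fun _ => (1 : ℝ) | ℱ n] :=
      condExp_mono (hξint n) (integrable_const 1) (.of_forall (h1 n))
    rw [condExp_const (ℱ.le n)] at e1
    filter_upwards [e0, e1] with ω e0 e1
    simp only [Pi.zero_apply] at e0
    simp only [hΔ, Pi.sub_apply]
    exact abs_le.2 ⟨by linarith [h0 n ω], by linarith [h1 n ω]⟩
  have hΔb' := ae_all_iff.2 hΔb
  have hSm : ∀ n, StronglyMeasurable[ℱ n] (S n) := fun n =>
    Finset.stronglyMeasurable_sum _ fun m hm' => (hΔm m).mono (ℱ.mono (mem_range.1 hm'))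
  have hSs : ∀ n, S (n + 1) = S n + Δ n := fun n => sum_range_succ _ _
  have hSb : ∀ n, ∀ᵐ ω ∂μ, |S n ω| ≤ n := by
    intro n
    filter_upwards [hΔb'] with ω hω
    simp only [hS, Finset.sum_apply]
    refine (abs_sum_le_sum_abs _ _).trans ((sum_le_sum fun m _ => hω m).trans ?_)
    simp
  have hΔm0 : ∀ n, AEStronglyMeasurable (Δ n) μ := fun n =>
    ((hΔm n).mono (ℱ.le _)).aestronglyMeasurable
  have hSm0 : ∀ n, AEStronglyMeasurable (S n) μ := fun n =>
    ((hSm n).mono (ℱ.le _)).aestronglyMeasurable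
  have hΔint : ∀ n, Integrable (Δ n) μ := fun n => Integrable.of_bound (hΔm0 n) 1 (hΔb n)
  have hSΔ : ∀ n, Integrable (S n * Δ n) μ := fun n =>
    (hΔint n).bdd_mul (hSm0 n) (hSb n)
  have hS2 : ∀ n, Integrable (S n * S n) μ := fun n =>
    (Integrable.of_bound (hSm0 n) n (hSb n)).bdd_mul (hSm0 n) (hSb n)
  have hΔ2 : ∀ n, Integrable (Δ n * Δ n) μ := fun n => (hΔint n).bdd_mul (hΔm0 n) (hΔb n)
  have horth : ∀ n, ∫ ω, (S n * Δ n) ω ∂μ = 0 := by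
    intro n
    have e1 : μ[Δ n | ℱ n] =ᵐ[μ] 0 := by
      have e2 := condExp_sub (hξint n) (integrable_condExp (μ := μ) (m := ℱ n) (f := ξ n)) (ℱ n)
      rw [condExp_of_stronglyMeasurable (ℱ.le n) stronglyMeasurable_condExp integrable_condExp,
        sub_self] at e2
      exact e2
    have e3 : μ[S n * Δ n | ℱ n] =ᵐ[μ] 0 := by
      filter_upwards [condExp_mul_of_stronglyMeasurable_left (hSm n) (hSΔ n) (hΔint n), e1]
        with ω e4 e5
      rw [e4, Pi.mul_apply, e5]
      simp
    rw [← integral_condExp (ℱ.le n), integral_congr_ae e3]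
    simp
  have hvar : ∀ n : ℕ, ∫ ω, (S n * S n) ω ∂μ ≤ n := by
    intro n
    induction n with
    | zero => simp [hS]
    | succ n ih =>
      have e1 : S (n + 1) * S (n + 1) = S n * S n + (2 : ℝ) • (S n * Δ n) + Δ n * Δ n := by
        rw [hSs]
        ext ω
        simp only [Pi.mul_apply, Pi.add_apply, Pi.smul_apply, smul_eq_mul]
        ring
      have e2 : ∫ ω, (Δ n * Δ n) ω ∂μ ≤ 1 := by
        refine (integral_mono_ae (hΔ2 n) (integrable_const 1) ?_).trans (by simp)
        filter_upwards [hΔb n] with ω hω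
        rw [Pi.mul_apply]
        nlinarith [abs_le.1 hω]
      rw [e1, integral_add' ((hS2 n).add ((hSΔ n).smul 2)) (hΔ2 n),
        integral_add' (hS2 n) ((hSΔ n).smul 2)]
      simp only [Pi.smul_apply]
      rw [integral_smul, horth, smul_zero]
      push_cast
      linarith
  set f : ℕ → Ω → ENNReal := fun k ω => ENNReal.ofReal ((S (k ^ 2) * S (k ^ 2)) ω / (k : ℝ) ^ 4)
    with hf
  have hfm : ∀ k, AEMeasurable (f k) μ := fun k =>
    ((hS2 (k ^ 2)).aestronglyMeasurable.aemeasurable.div_const _).ennreal_ofReal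
  have hfint : ∀ k, ∫⁻ ω, f k ω ∂μ ≤ ENNReal.ofReal (1 / (k : ℝ) ^ 2) := by
    intro k
    rw [hf, ← ofReal_integral_eq_lintegral_ofReal ((hS2 (k ^ 2)).div_const _)
      (.of_forall fun ω => div_nonneg (mul_self_nonneg _) (by positivity)), integral_div]
    refine ENNReal.ofReal_le_ofReal ?_
    rcases k.eq_zero_or_pos with rfl | hk
    · simp
    · have hk' : (0 : ℝ) < k := by exact_mod_cast hk
      rw [div_le_div_iff₀ (by positivity) (by positivity)]
      have := hvar (k ^ 2)
      push_cast at this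
      nlinarith [mul_le_mul_of_nonneg_right this (sq_nonneg (k : ℝ))]
  have hsum : ∑' k, ∫⁻ ω, f k ω ∂μ ≠ ⊤ := by
    refine ne_top_of_le_ne_top ?_ (ENNReal.tsum_le_tsum hfint)
    exact (Real.summable_one_div_nat_pow.2 one_lt_two).tsum_ofReal_ne_top
  rw [← lintegral_tsum hfm] at hsum
  filter_upwards [ae_lt_top' (AEMeasurable.tsum hfm) hsum, hΔb'] with ω hω hωb
  have hlim := ENNReal.tendsto_atTop_zero_of_tsum_ne_top hω.ne
  have hfun : (fun n => ∑ m ∈ range n, (ξ m ω - (μ[ξ m | ℱ m]) ω)) = fun n => S n ω := by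
    funext n
    simp [hS, hΔ]
  rw [hfun]
  refine isLittleO_natCast_of_subseq_sq (fun n => ?_) ?_
  · simpa [hSs] using hωb n
  · have e1 := (ENNReal.tendsto_toReal ENNReal.zero_ne_top).comp hlim
    have e2 : Tendsto (fun k : ℕ => (S (k ^ 2) ω / (k : ℝ) ^ 2) ^ 2) atTop (𝓝 0) := by
      refine e1.congr fun k => ?_
      simp only [Function.comp, hf, Pi.mul_apply]
      rw [ENNReal.toReal_ofReal (div_nonneg (mul_self_nonneg _) (by positivity))]
      ring
    have e3 := (Real.continuous_sqrt.tendsto 0).comp e2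
    simp only [Function.comp_def, Real.sqrt_sq_eq_abs, Real.sqrt_zero] at e3
    exact (tendsto_zero_iff_abs_tendsto_zero _).2 e3

theorem IsCompact.eventually_mem_of_tendsto_zero {E ι : Type*} [TopologicalSpace E] {K U : Set E}
    (hK : IsCompact K) (hU : IsOpen U) {F : E → ℝ} (hF : Continuous F) (hF0 : ∀ x, 0 ≤ F x)
    (hKU : ∀ x ∈ K, F x = 0 → x ∈ U) {f : Filter ι} {x : ι → E} (hx : ∀ᶠ i in f, x i ∈ K)
    (hxF : Tendsto (fun i => F (x i)) f (𝓝 0)) : ∀ᶠ i in f, x i ∈ U := by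
  rcases (K \ U).eq_empty_or_nonempty with h | h
  · exact hx.mono fun i hi => Set.sdiff_eq_empty.1 h hi
  · obtain ⟨z, hz, hzmin⟩ := (hK.diff hU).exists_isMinOn h hF.continuousOn
    have hz0 : 0 < F z := (hF0 z).lt_of_ne fun h0 => hz.2 (hKU z hz.1 h0.symm)
    filter_upwards [hx, hxF.eventually_lt_const hz0] with i hi hi'
    by_contra hiU
    exact (hzmin ⟨hi, hiU⟩ : F z ≤ F (x i)).not_gt hi'

open scoped Pointwise in
theorem tendsto_infDist_smul {E : Type*} [NormedAddCommGroup E] [NormedSpace ℝ E] {S : Set E}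
    {f G : ℕ → E} {c : ℝ} (hc : 0 < c)
    (hG : Tendsto (fun n : ℕ => Metric.infDist ((n : ℝ)⁻¹ • G n) S) atTop (𝓝 0))
    (hf : (fun n => f n - c • G n) =o[atTop] (fun n : ℕ => (n : ℝ))) :
    Tendsto (fun n : ℕ => Metric.infDist ((n : ℝ)⁻¹ • f n) (c • S)) atTop (𝓝 0) := by
  have h1 := hf.tendsto_inv_smul_nhds_zero.norm
  have h2 := (hG.const_mul c).add h1
  rw [mul_zero, norm_zero, add_zero] at h2
  refine squeeze_zero (fun _ => Metric.infDist_nonneg) (fun n => ?_) h2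
  refine (Metric.infDist_le_infDist_add_dist (y := c • (n : ℝ)⁻¹ • G n)).trans ?_
  rw [infDist_smul₀ hc.ne', Real.norm_of_nonneg hc.le, dist_eq_norm, smul_sub,
    smul_comm c]

namespace Urn

variable {d : ℕ}

theorem rmul_basis (k : Fin d) (A : Fin d → Fin d → ℝ) : rmul (basis k) A = A k := by
  funext q
  simp [rmul, basis]

namespace UrnFlow

variable {H : Fin d → Fin d → ℝ} {u : Fin d → ℝ} {pr Y : ℕ → Fin d → ℝ}

theorem inv_smul_sum_mem_simplex {l : ℝ} (h : UrnFlow H u l pr Y) :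
    ∀ᶠ n : ℕ in atTop, (n : ℝ)⁻¹ • ∑ m ∈ range n, pr m ∈ simplex d := by
  filter_upwards [eventually_gt_atTop 0] with n hn
  have hn' : (0 : ℝ) < n := by exact_mod_cast hn
  obtain ⟨h1, h2⟩ := sum_mem_simplex h.mem_simplex n
  refine ⟨fun k => mul_nonneg (by positivity) (h1 k), ?_⟩
  simp only [Pi.smul_apply, smul_eq_mul, ← mul_sum, h2]
  field_simp

theorem eventually_mem_of_SH_subset (h : UrnFlow H u (lamH H) pr Y) {U : Set (Fin d → ℝ)}
    (hU : IsOpen U) (hSU : SH H ⊆ U) :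
    ∀ᶠ n : ℕ in atTop, (n : ℝ)⁻¹ • ∑ m ∈ range n, pr m ∈ U := by
  have hK : IsCompact (simplex d) := isCompact_stdSimplex ℝ (Fin d)
  refine hK.eventually_mem_of_tendsto_zero hU (F := fun g => ‖rmulCLM H g - lamH H • g‖)
    (by fun_prop) (fun _ => norm_nonneg _) (fun g hg hg0 => hSU ⟨hg, ?_⟩)
    h.inv_smul_sum_mem_simplex ?_
  · exact sub_eq_zero.1 (norm_eq_zero.1 hg0)
  · have h1 := h.rmul_sub_smul_isLittleO.tendsto_inv_smul_nhds_zero.norm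
    rw [norm_zero] at h1
    refine h1.congr fun n => ?_
    rw [map_smul, smul_sub, smul_comm (lamH H), rmulCLM_apply]

theorem SH_nonempty (h : UrnFlow H u (lamH H) pr Y) : (SH H).Nonempty := by
  by_contra hS
  rw [Set.not_nonempty_iff_eq_empty] at hS
  obtain ⟨n, hn⟩ := (h.eventually_mem_of_SH_subset isOpen_empty hS.subset).exists
  exact hn

theorem tendsto_infDist_SH (h : UrnFlow H u (lamH H) pr Y) :
    Tendsto (fun n : ℕ => Metric.infDist ((n : ℝ)⁻¹ • ∑ m ∈ range n, pr m) (SH H)) atTop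
      (𝓝 0) := by
  rw [Metric.tendsto_nhds]
  intro ε hε
  filter_upwards [h.eventually_mem_of_SH_subset Metric.isOpen_thickening
    (Metric.self_subset_thickening hε _)] with n hn
  rw [dist_zero_right, Real.norm_of_nonneg Metric.infDist_nonneg]
  exact ((Metric.mem_thickening_iff_infDist_lt h.SH_nonempty).1 hn)

theorem tendsto_infDist_div (h : UrnFlow H u (lamH H) pr Y) :
    Tendsto (fun n : ℕ => Metric.infDist (fun k => Y n k / (n : ℝ)) (lamSH H)) atTop (𝓝 0) := by
  refine (tendsto_infDist_smul h.eig_pos h.tendsto_infDist_SH h.sub_smul_isLittleO).congr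
    fun n => ?_
  congr 1
  funext k
  exact inv_mul_eq_div _ _

theorem tendsto_infDist_vpos_div (h : UrnFlow H u (lamH H) pr Y) :
    Tendsto (fun n : ℕ => Metric.infDist (fun k => vpos (Y n) k / (n : ℝ)) (lamSH H)) atTop
      (𝓝 0) := by
  refine (tendsto_infDist_smul h.eig_pos h.tendsto_infDist_SH h.vpos_sub_smul_isLittleO).congr
    fun n => ?_
  congr 1
  funext k
  exact inv_mul_eq_div _ _

open scoped Pointwise in
theorem tendsto_infDist_div_of_isLittleO (h : UrnFlow H u (lamH H) pr Y) {N : ℕ → Fin d → ℝ}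
    (hN : (fun n => N n - ∑ m ∈ range n, pr m) =o[atTop] (fun n : ℕ => (n : ℝ))) :
    Tendsto (fun n : ℕ => Metric.infDist (fun k => N n k / (n : ℝ)) (SH H)) atTop (𝓝 0) := by
  refine (tendsto_infDist_smul (c := 1) one_pos h.tendsto_infDist_SH
    (by simpa using hN)).congr fun n => ?_
  rw [one_smul]
  congr 1
  funext k
  exact inv_mul_eq_div _ _

theorem tendsto_infDist_vpos_div_asum (h : UrnFlow H u (lamH H) pr Y) :
    Tendsto (fun n : ℕ => Metric.infDist (fun k => vpos (Y n) k / asum (vpos (Y n))) (SH H)) atTop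
      (𝓝 0) := by
  refine (h.tendsto_infDist_div_of_isLittleO h.smul_pr_sub_isLittleO).congr' ?_
  filter_upwards [h.eventually_asum_vpos_pos, eventually_gt_atTop 0] with n hn hn0
  have hn' : (n : ℝ) ≠ 0 := by exact_mod_cast hn0.ne'
  rw [← h.pr_eq n hn]
  congr 1
  funext k
  simp [hn']

end UrnFlow

/-- A nonnegative left eigenvector of an irreducible matrix with nonnegative off-diagonal entries
vanishes as soon as one of its coordinates does. -/
theorem eq_zero_of_irred {H : Fin d → Fin d → ℝ} {l : ℝ} (hH : ∀ q k, q ≠ k → 0 ≤ H q k)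
    (hI : Irred H) {v : Fin d → ℝ} (hv : ∀ k, 0 ≤ v k) (hvH : rmul v H = l • v) {q : Fin d}
    (hq : v q = 0) : v = 0 := by
  have step : ∀ i j, i ≠ j ∧ H i j ≠ 0 → v j = 0 → v i = 0 := by
    intro i j ⟨hij, hne⟩ hj
    have h1 : ∑ k, v k * H k j = 0 := by
      have := congrFun hvH j
      simpa [rmul, hj] using this
    have h2 : ∀ k ∈ univ, 0 ≤ v k * H k j := by
      intro k _
      rcases eq_or_ne k j with rfl | hkj
      · simp [hj]
      · exact mul_nonneg (hv k) (hH k j hkj)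
    have h3 := (sum_eq_zero_iff_of_nonneg h2).1 h1 i (mem_univ i)
    exact (mul_eq_zero.1 h3).resolve_right hne
  funext k
  rcases eq_or_ne k q with rfl | hkq
  · exact hq
  · have h := hI k q hkq
    induction h using Relation.TransGen.head_induction_on with
    | single h => exact step _ _ h hq
    | head h _ ih =>
      rename_i a c _
      rcases eq_or_ne c q with rfl | hc
      · exact step _ _ h hq
      · exact step _ _ h (ih hc)

theorem SH_subsingleton {H : Fin d → Fin d → ℝ} (hH : ∀ q k, q ≠ k → 0 ≤ H q k)
    (hI : Irred H) : (SH H).Subsingleton := by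
  intro v hv w hw
  have hpos : ∀ k, 0 < w k := fun k => (hw.1.1 k).lt_of_ne fun h0 => by
    have h1 := hw.1.2
    simp [eq_zero_of_irred hH hI hw.1.1 hw.2 h0.symm] at h1
  have hne : (univ : Finset (Fin d)).Nonempty := by
    by_contra h
    have h1 := hw.1.2
    simp [not_nonempty_iff_eq_empty.1 h] at h1
  obtain ⟨q, -, hq⟩ := exists_min_image univ (fun k => v k / w k) hne
  set t := v q / w q with ht
  have h0 : v - t • w = 0 := by
    refine eq_zero_of_irred hH hI (l := lamH H) (q := q) (fun k => ?_) ?_ ?_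
    · have := (le_div_iff₀ (hpos k)).1 (hq k (mem_univ k))
      simpa using this
    · rw [← rmulCLM_apply, map_sub, map_smul, rmulCLM_apply, rmulCLM_apply, hv.2, hw.2, smul_sub,
        smul_comm t]
    · have := (hpos q).ne'
      simp only [Pi.sub_apply, Pi.smul_apply, smul_eq_mul, ht]
      field_simp
      simp
  have h1 : v = t • w := sub_eq_zero.1 h0
  have h2 := hv.1.2
  rw [h1] at h2
  simp only [Pi.smul_apply, smul_eq_mul, ← mul_sum, hw.1.2, mul_one] at h2
  rw [h1, h2, one_smul]

theorem sub_rmul_Ncount_isLittleO {H : Fin d → Fin d → ℝ} {D Hc : ℕ → Fin d → Fin d → ℝ}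
    {x Y : ℕ → Fin d → ℝ} (hY : ∀ n, Y (n + 1) = Y n + rmul (x (n + 1)) (D (n + 1)))
    (hx : ∀ n, ∃ k, x (n + 1) = basis k)
    (hces : Tendsto (fun n : ℕ => (∑ m ∈ Icc 1 n, ‖Hc m - H‖) / n) atTop (𝓝 0))
    {M : ℕ → Fin d → ℝ} (hM0 : M 0 = 0)
    (hMs : ∀ n, M (n + 1) = M n + rmul (x (n + 1)) (D (n + 1) - Hc (n + 1)))
    (hM : Tendsto (fun n : ℕ => ‖M n‖ / n) atTop (𝓝 0)) :
    (fun n => Y n - rmul (∑ m ∈ range n, x (m + 1)) H) =o[atTop] (fun n : ℕ => (n : ℝ)) := by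
  have hrmul_sub : ∀ (y : Fin d → ℝ) (A B : Fin d → Fin d → ℝ), rmul y (A - B) = rmul y A - rmul y B :=
    fun y A B => by
      funext q
      simp [rmul, mul_sub, sum_sub_distrib]
  have key : ∀ n, ‖Y n - rmul (∑ m ∈ range n, x (m + 1)) H - M n‖ ≤
      ‖Y 0‖ + ∑ m ∈ Icc 1 n, ‖Hc m - H‖ := by
    intro n
    induction n with
    | zero =>
      rw [range_zero, sum_empty, ← rmulCLM_apply, map_zero, hM0]
      simp
    | succ n ih =>
      obtain ⟨k, hk⟩ := hx n
      have h1 : Y (n + 1) - rmul (∑ m ∈ range (n + 1), x (m + 1)) H - M (n + 1) =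
          (Y n - rmul (∑ m ∈ range n, x (m + 1)) H - M n) + rmul (x (n + 1)) (Hc (n + 1) - H) := by
        rw [hY, hMs, sum_range_succ, ← rmulCLM_apply H, map_add, hrmul_sub, hrmul_sub]
        simp only [rmulCLM_apply]
        abel
      have h2 : ‖rmul (x (n + 1)) (Hc (n + 1) - H)‖ ≤ ‖Hc (n + 1) - H‖ := by
        rw [hk, rmul_basis]
        exact norm_le_pi_norm _ k
      rw [h1, sum_Icc_succ_top (by omega), ← add_assoc]
      exact (norm_add_le _ _).trans (add_le_add ih h2)
  have e1 : (fun n => M n) =o[atTop] (fun n : ℕ => (n : ℝ)) :=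
    (isLittleO_iff_tendsto' (by
      filter_upwards [eventually_gt_atTop 0] with n hn h0
      exact absurd h0 (by exact_mod_cast hn.ne'))).2 hM |>.of_norm_left
  have e2 : (fun n => ∑ m ∈ Icc 1 n, ‖Hc m - H‖) =o[atTop] (fun n : ℕ => (n : ℝ)) :=
    (isLittleO_iff_tendsto' (by
      filter_upwards [eventually_gt_atTop 0] with n hn h0
      exact absurd h0 (by exact_mod_cast hn.ne'))).2 hces
  have e3 : (fun _ : ℕ => ‖Y 0‖) =o[atTop] (fun n : ℕ => (n : ℝ)) :=
    isLittleO_const_left.2 (.inr (by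
      simpa [Function.comp_def] using tendsto_natCast_atTop_atTop (R := ℝ)))
  have e4 : (fun n => Y n - rmul (∑ m ∈ range n, x (m + 1)) H - M n) =o[atTop]
      (fun n : ℕ => (n : ℝ)) :=
    IsBigO.trans_isLittleO (IsBigO.of_bound 1 (.of_forall fun n => by
      rw [one_mul]
      exact (key n).trans (Real.le_norm_self _))) (e3.add e2)
  simpa using e4.add e1

/-- conditional draw probabilities given the composition `y` -/
def drawProb (p y : Fin d → ℝ) : Fin d → ℝ := fun k =>
  if 0 < asum (vpos y) then vpos y k / asum (vpos y) else p k

theorem drawProb_mem_simplex {p : Fin d → ℝ} (hp0 : ∀ k, 0 ≤ p k) (hp1 : ∑ k, p k = 1)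
    (y : Fin d → ℝ) : drawProb p y ∈ simplex d := by
  by_cases h : 0 < asum (vpos y)
  · unfold drawProb
    simp only [h, if_true]
    exact ⟨fun k => div_nonneg (vpos_nonneg y k) h.le, by rw [← sum_div]; exact div_self h.ne'⟩
  · unfold drawProb
    simp only [h, if_false]
    exact ⟨hp0, hp1⟩

theorem Ncount_eq {Ω : Type*} (X : ℕ → Ω → Fin d → ℝ) (n : ℕ) (ω : Ω) :
    Ncount X n ω = ∑ m ∈ range n, X (m + 1) ω := by
  funext k
  rw [Ncount, Finset.sum_apply, ← Finset.Ico_add_one_right_eq_Icc, sum_Ico_eq_sum_range]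
  exact sum_congr rfl fun m _ => by rw [add_comm]

theorem ae_urnFlow {Ω : Type*} {m0 : MeasurableSpace Ω} (μ : Measure Ω) [IsProbabilityMeasure μ]
    (ℱ : Filtration ℕ m0) {D Hc : ℕ → Ω → Fin d → Fin d → ℝ} {X Y : ℕ → Ω → Fin d → ℝ}
    {p : Fin d → ℝ} {H : Ω → Fin d → Fin d → ℝ} (hmodel : IsUrnModel μ ℱ D X Y p)
    (hA3 : ∀ᵐ ω ∂μ, A3 (H ω))
    (hces : ∀ᵐ ω ∂μ, Tendsto
      (fun n : ℕ => (∑ m ∈ Icc 1 n, ‖Hc m ω - H ω‖) / n) atTop (𝓝 0))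
    (hM2 : ∀ᵐ ω ∂μ, Tendsto (fun n : ℕ => ‖M2 X D Hc n ω‖ / n) atTop (𝓝 0)) :
    ∀ᵐ ω ∂μ, (∃ u, UrnFlow (H ω) u (lamH (H ω)) (fun n => drawProb p (Y n ω)) (fun n => Y n ω)) ∧
      (fun n => Ncount X n ω - ∑ m ∈ range n, drawProb p (Y m ω)) =o[atTop]
        (fun n : ℕ => (n : ℝ)) := by
  obtain ⟨-, -, hY, hp0, hp1, hX, hXm, -, hce⟩ := hmodel
  have hX01 : ∀ n ω k, 0 ≤ X (n + 1) ω k ∧ X (n + 1) ω k ≤ 1 := by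
    intro n ω k
    obtain ⟨j, hj⟩ := hX n ω
    rw [hj, basis]
    split_ifs <;> simp
  have hslln : ∀ᵐ ω ∂μ, ∀ k, (fun n => ∑ m ∈ range n,
      (X (m + 1) ω k - (μ[fun ω => X (m + 1) ω k | ℱ m]) ω)) =o[atTop] (fun n : ℕ => (n : ℝ)) :=
    ae_all_iff.2 fun k => ae_sum_sub_condExp_isLittleO μ ℱ
      (ξ := fun n ω => X (n + 1) ω k)
      (fun n => ((measurable_pi_apply k).comp (hXm (n + 1) (by omega))).stronglyMeasurable)
      (fun n ω => (hX01 n ω k).1) (fun n ω => (hX01 n ω k).2)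
  have hce' := ae_all_iff.2 fun n => ae_all_iff.2 fun k => hce n k
  filter_upwards [hA3, hces, hM2, hslln, hce'] with ω ⟨hoff, ⟨u, hu, hHu⟩, hl⟩ hces hM2 hslln hce
  have hN : (fun n => Ncount X n ω - ∑ m ∈ range n, drawProb p (Y m ω)) =o[atTop]
      (fun n : ℕ => (n : ℝ)) := by
    refine isLittleO_pi.2 fun k => (hslln k).congr_left fun n => ?_
    rw [Ncount_eq, ← sum_sub_distrib, Finset.sum_apply]
    refine sum_congr rfl fun m _ => ?_
    rw [hce m k]
    rfl
  refine ⟨⟨u, ⟨hoff, hu, hHu, hl, fun n => drawProb_mem_simplex hp0 hp1 _, fun n hn => ?_, ?_⟩⟩, hN⟩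
  · funext k
    simp only [drawProb, hn, if_true]
  · have h1 := sub_rmul_Ncount_isLittleO (H := H ω) (D := fun n => D n ω) (Hc := fun n => Hc n ω)
      (x := fun n => X n ω) (Y := fun n => Y n ω) (M := fun n => M2 X D Hc n ω)
      (fun n => hY n ω) (fun n => hX n ω) hces (by funext q; simp [M2])
      (fun n => by
        funext q
        simp [M2, rmul, sum_Icc_succ_top]) hM2
    have h2 := (rmulCLM (H ω)).isBigO_comp (fun n => Ncount X n ω - ∑ m ∈ range n,
      drawProb p (Y m ω)) atTop |>.trans_isLittleO hN
    refine (h1.add h2).congr_left fun n => ?_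
    rw [map_sub, Ncount_eq, rmulCLM_apply, rmulCLM_apply]
    abel

end Urn

/-- Theorem 3.1: non-homogeneous replacement. If
`(1/n)∑_{m≤n}‖H_m − H‖ → 0` a.s. for a random matrix `H` satisfying A3 a.s.,
and `‖M_{n,2}‖/n → 0` a.s., then the four distance convergences hold a.s.;
if moreover `H` is a.s. irreducible then `S_H` is a single random point `v`
and the proportions converge a.s. to it. -/
theorem stmt9
    {Ω : Type*} {m0 : MeasurableSpace Ω} (μ : Measure Ω) [IsProbabilityMeasure μ]
    (ℱ : Filtration ℕ m0) {d : ℕ}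
    (D Hc : ℕ → Ω → Fin d → Fin d → ℝ) (X : ℕ → Ω → Fin d → ℝ)
    (Y : ℕ → Ω → Fin d → ℝ) (p : Fin d → ℝ) (H : Ω → Fin d → Fin d → ℝ)
    (hmodel : Urn.IsUrnModel μ ℱ D X Y p)
    (hHc : Urn.IsCondMean μ ℱ D Hc)
    (hA3 : ∀ᵐ ω ∂μ, Urn.A3 (H ω))
    (hces : ∀ᵐ ω ∂μ, Tendsto
      (fun n : ℕ => (∑ m ∈ Finset.Icc 1 n, ‖Hc m ω - H ω‖) / n) atTop (𝓝 0))
    (hM2 : ∀ᵐ ω ∂μ, Tendsto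
      (fun n : ℕ => ‖Urn.M2 X D Hc n ω‖ / n) atTop (𝓝 0)) :
    (∀ᵐ ω ∂μ,
      Tendsto (fun n : ℕ =>
        Metric.infDist (fun k => Y n ω k / (n:ℝ)) (Urn.lamSH (H ω))) atTop (𝓝 0) ∧
      Tendsto (fun n : ℕ =>
        Metric.infDist (fun k => Urn.vpos (Y n ω) k / (n:ℝ)) (Urn.lamSH (H ω)))
        atTop (𝓝 0) ∧
      Tendsto (fun n : ℕ =>
        Metric.infDist (fun k => Urn.vpos (Y n ω) k / Urn.asum (Urn.vpos (Y n ω)))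
          (Urn.SH (H ω))) atTop (𝓝 0) ∧
      Tendsto (fun n : ℕ =>
        Metric.infDist (fun k => Urn.Ncount X n ω k / (n:ℝ)) (Urn.SH (H ω)))
        atTop (𝓝 0)) ∧
    ((∀ᵐ ω ∂μ, Urn.Irred (H ω)) →
      ∃ v : Ω → Fin d → ℝ, ∀ᵐ ω ∂μ, Urn.SH (H ω) = {v ω} ∧
        Tendsto (fun n : ℕ => (fun k => Y n ω k / (n:ℝ))) atTop
          (𝓝 (Urn.lamH (H ω) • v ω)) ∧
        Tendsto (fun n : ℕ =>
          (fun k => Urn.vpos (Y n ω) k / Urn.asum (Urn.vpos (Y n ω)))) atTop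
          (𝓝 (v ω)) ∧
        Tendsto (fun n : ℕ => (fun k => Urn.Ncount X n ω k / (n:ℝ))) atTop
          (𝓝 (v ω))) := by
  have hflow := Urn.ae_urnFlow μ ℱ hmodel hA3 hces hM2
  refine ⟨?_, fun hI => ?_⟩
  · filter_upwards [hflow] with ω ⟨⟨u, h⟩, hN⟩
    exact ⟨h.tendsto_infDist_div, h.tendsto_infDist_vpos_div, h.tendsto_infDist_vpos_div_asum,
      h.tendsto_infDist_div_of_isLittleO hN⟩
  · classical
    refine ⟨fun ω => if h : (Urn.SH (H ω)).Nonempty then h.some else 0, ?_⟩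
    filter_upwards [hflow, hI] with ω ⟨⟨u, h⟩, hN⟩ hI
    rw [dif_pos h.SH_nonempty]
    set v := h.SH_nonempty.some
    have hv : Urn.SH (H ω) = {v} :=
      (Urn.SH_subsingleton h.offDiag hI).eq_singleton_of_mem h.SH_nonempty.some_mem
    have h1 := h.tendsto_infDist_div
    have h2 := h.tendsto_infDist_vpos_div_asum
    have h3 := h.tendsto_infDist_div_of_isLittleO hN
    simp only [Urn.lamSH, hv, Set.image_singleton, Metric.infDist_singleton] at h1 h2 h3
    exact ⟨hv, tendsto_iff_dist_tendsto_zero.2 h1, tendsto_iff_dist_tendsto_zero.2 h2,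
      tendsto_iff_dist_tendsto_zero.2 h3⟩
end
end

section
/- Let H be a d×d real matrix satisfying Assumption A3, and let Θ₀ = {θ ∈ ℝ^d : θ ≥ 0 componentwise, α(θ) ≤ C₀, θ·uᵗ ≥ c₀}, where 0 < c₀, C₀ < ∞ are constants with λ_H·S_H ⊆ Θ₀. Define h(θ) = θ·(I_d − H/α(θ)) for α(θ) > 0. If θ : ℝ → ℝ^d is a differentiable solution of the ODE dθ(t)/dt = −h(θ(t)) for all t ∈ ℝ with θ(t) ∈ Θ₀ for all t ∈ (−∞, ∞), then θ(0) ∈ λ_H·S_H and θ(t) = θ(0) for all t. -/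
open MeasureTheory Filter Topology Finset ProbabilityTheory Asymptotics

noncomputable section

namespace Urn

/-- The linear map `x ↦ x · H - c x` of row vectors. -/
def rmulShift {d : ℕ} (H : Fin d → Fin d → ℝ) (c : ℝ) : (Fin d → ℝ) →L[ℝ] (Fin d → ℝ) :=
  LinearMap.toContinuousLinearMap
    (Matrix.vecMulLinear (Matrix.of H) - c • LinearMap.id)

theorem rmulShift_apply {d : ℕ} (H : Fin d → Fin d → ℝ) (c : ℝ) (x : Fin d → ℝ) :
    rmulShift H c x = rmul x H - c • x := by
  ext q
  simp [rmulShift, rmul, Matrix.vecMul, dotProduct]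

theorem hasDerivAt_exp_smul_apply {E : Type*} [NormedAddCommGroup E] [NormedSpace ℝ E]
    [CompleteSpace E] (L : E →L[ℝ] E) (x : E) (s : ℝ) :
    HasDerivAt (fun s : ℝ => NormedSpace.exp (s • L) x) (L (NormedSpace.exp (s • L) x)) s := by
  simpa using (hasDerivAt_exp_smul_const' (𝕂 := ℝ) L s).clm_apply (hasDerivAt_const s x)

theorem exp_smul_add_apply {E : Type*} [NormedAddCommGroup E] [NormedSpace ℝ E]
    [CompleteSpace E] (L : E →L[ℝ] E) (x : E) (s t : ℝ) :
    NormedSpace.exp (s • L) (NormedSpace.exp (t • L) x) = NormedSpace.exp ((s + t) • L) x := by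
  let _ : NormedAlgebra ℚ (E →L[ℝ] E) := NormedAlgebra.restrictScalars ℚ ℝ _
  rw [add_smul, NormedSpace.exp_add_of_commute
    (((Commute.refl L).smul_left s).smul_right t)]
  rfl

theorem exp_smul_comm_apply {E : Type*} [NormedAddCommGroup E] [NormedSpace ℝ E]
    [CompleteSpace E] (L : E →L[ℝ] E) (x : E) (s : ℝ) :
    NormedSpace.exp (s • L) (L x) = L (NormedSpace.exp (s • L) x) := by
  have h : Commute (NormedSpace.exp (s • L)) L :=
    (((Commute.refl L).smul_left s)).exp_left
  exact congrArg (fun T : E →L[ℝ] E => T x) h.eq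

theorem apply_exp_smul_of_apply_eq_zero {E : Type*} [NormedAddCommGroup E] [NormedSpace ℝ E]
    [CompleteSpace E] (L : E →L[ℝ] E) (f : E →L[ℝ] ℝ) (hf : ∀ x, f (L x) = 0) (x : E) (s : ℝ) :
    f (NormedSpace.exp (s • L) x) = f x := by
  have hd : ∀ t, HasDerivAt (fun s : ℝ => f (NormedSpace.exp (s • L) x)) 0 t := fun t => by
    have := f.hasFDerivAt.comp_hasDerivAt t (hasDerivAt_exp_smul_apply L x t)
    rwa [hf] at this
  have := is_const_of_deriv_eq_zero (fun t => (hd t).differentiableAt)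
    (fun t => (hd t).deriv) s 0
  simpa using this

/-- A linear functional composed with the generator is nonpositive on a compact set which is
invariant under the flow of the generator and under `1 + r⁻¹ L`. -/
theorem apply_generator_nonpos {E : Type*} [NormedAddCommGroup E] [NormedSpace ℝ E]
    [CompleteSpace E] (L : E →L[ℝ] E) (K : Set E) (hK : IsCompact K) (r : ℝ) (hr : 0 < r)
    (hflow : ∀ x ∈ K, ∀ s : ℝ, NormedSpace.exp (s • L) x ∈ K)
    (hinv : ∀ x ∈ K, r⁻¹ • (L x + r • x) ∈ K) (f : E →L[ℝ] ℝ) {x : E} (hx : x ∈ K) :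
    f (L x) ≤ 0 := by
  obtain ⟨y, hyK, hy⟩ := hK.exists_isMaxOn ⟨x, hx⟩ (f.comp L).continuous.continuousOn
  replace hy : ∀ z ∈ K, f (L z) ≤ f (L y) := fun z hz => hy hz
  refine (hy x hx).trans ?_
  set M := f (L y) with hM
  set γ : ℝ → E := fun s => NormedSpace.exp (s • L) y with hγ
  have hγK : ∀ s, γ s ∈ K := hflow y hyK
  have hγ' : ∀ s, HasDerivAt γ (L (γ s)) s := hasDerivAt_exp_smul_apply L y
  have hγ0 : γ 0 = y := by simp [hγ]
  have hfγ : ∀ s, HasDerivAt (fun s => f (γ s)) (f (L (γ s))) s := fun s =>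
    f.hasFDerivAt.comp_hasDerivAt s (hγ' s)
  have hfLγ : ∀ s, HasDerivAt (fun s => f (L (γ s))) (f (L (L (γ s)))) s := fun s =>
    (f.comp L).hasFDerivAt.comp_hasDerivAt s (hγ' s)
  have hD : ∀ s, HasDerivAt (fun s => Real.exp (r * s) * (M - f (L (γ s))))
      (Real.exp (r * s) * r * (M - f (L (γ s))) + Real.exp (r * s) * (-f (L (L (γ s))))) s := by
    intro s
    have h1 : HasDerivAt (fun s => Real.exp (r * s)) (Real.exp (r * s) * r) s := by
      simpa using ((hasDerivAt_id s).const_mul r).exp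
    exact h1.mul ((hfLγ s).const_sub M)
  have hmono : Monotone (fun s => Real.exp (r * s) * (M - f (L (γ s)))) := by
    refine monotone_of_hasDerivAt_nonneg hD fun s => ?_
    have h1 := hy _ (hinv _ (hγK s))
    simp only [map_smul, map_add, smul_eq_mul] at h1
    rw [inv_mul_le_iff₀ hr] at h1
    have h2 := mul_nonneg (Real.exp_pos (r * s)).le (sub_nonneg.2 h1)
    simp only [Pi.zero_apply]
    linarith
  have hconst : ∀ s ≤ 0, f (L (γ s)) = M := by
    intro s hs
    refine le_antisymm (hy _ (hγK s)) ?_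
    have h1 := hmono hs
    simp only [hγ0, ← hM, sub_self, mul_zero] at h1
    have h2 := nonpos_of_mul_nonpos_right h1 (Real.exp_pos (r * s))
    linarith
  obtain ⟨B, hB⟩ := (hK.image f.continuous).isBounded.exists_norm_le
  have hBγ : ∀ s, |f (γ s)| ≤ B := fun s => hB _ ⟨_, hγK s, rfl⟩
  by_contra! hpos
  have hB0 : 0 ≤ B := (abs_nonneg _).trans (hBγ 0)
  set s : ℝ := -((2 * B + 1) / M) with hs
  have hs0 : s < 0 := by
    rw [hs]
    have : 0 < (2 * B + 1) / M := by positivity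
    linarith
  obtain ⟨c, hc, hc'⟩ := exists_hasDerivAt_eq_slope (fun s => f (γ s)) (fun s => f (L (γ s))) hs0
    (fun t _ => (hfγ t).continuousAt.continuousWithinAt) (fun t _ => hfγ t)
  rw [hconst c hc.2.le, eq_div_iff (by linarith)] at hc'
  have h1 : M * (0 - s) = 2 * B + 1 := by
    rw [hs]; field_simp; ring
  have h2 := abs_le.1 (hBγ 0)
  have h3 := abs_le.1 (hBγ s)
  linarith [h2.2, h3.1]

/-- If the whole two-sided orbit of `x` under a Metzler generator with a positive right null
vector is nonnegative, then `x` is a fixed point. -/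
theorem apply_eq_zero_of_exp_nonneg {d : ℕ} (L : (Fin d → ℝ) →L[ℝ] (Fin d → ℝ))
    (u : Fin d → ℝ) (hu : ∀ k, 0 < u k) (hLu : ∀ x, ∑ k, L x k * u k = 0)
    (r : ℝ) (hr : 0 < r) (hL : ∀ x, 0 ≤ x → 0 ≤ L x + r • x) (x : Fin d → ℝ)
    (hx : ∀ s : ℝ, 0 ≤ NormedSpace.exp (s • L) x) : L x = 0 := by
  let ℓ : (Fin d → ℝ) →L[ℝ] ℝ := ∑ k, u k • ContinuousLinearMap.proj k
  have hℓ : ∀ y, ℓ y = ∑ k, y k * u k := fun y => by simp [ℓ, mul_comm]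
  have hℓL : ∀ y, ℓ (L y) = 0 := fun y => (hℓ _).trans (hLu y)
  let K : Set (Fin d → ℝ) := {y | ℓ y = ℓ x ∧ ∀ s : ℝ, 0 ≤ NormedSpace.exp (s • L) y}
  have hnn : ∀ y ∈ K, 0 ≤ y := fun y hy => by simpa using hy.2 0
  have hKc : IsClosed K := by
    refine (isClosed_eq ℓ.continuous continuous_const).inter ?_
    have h : IsClosed (⋂ s : ℝ, {y | 0 ≤ NormedSpace.exp (s • L) y}) :=
      isClosed_iInter fun s => isClosed_le continuous_const (NormedSpace.exp (s • L)).continuous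
    rwa [← Set.ofPred_forall] at h
  have hK : IsCompact K := by
    refine (isCompact_Icc (a := (0 : Fin d → ℝ)) (b := fun k => ℓ x / u k)).of_isClosed_subset
      hKc fun y hy => ⟨hnn y hy, fun k => ?_⟩
    rw [le_div_iff₀ (hu k), ← hy.1, hℓ]
    exact Finset.single_le_sum (f := fun k => y k * u k)
      (fun j _ => mul_nonneg (hnn y hy j) (hu j).le) (Finset.mem_univ k)
  have hflow : ∀ y ∈ K, ∀ s : ℝ, NormedSpace.exp (s • L) y ∈ K := fun y hy s =>
    ⟨(apply_exp_smul_of_apply_eq_zero L ℓ hℓL y s).trans hy.1, fun t => by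
      rw [exp_smul_add_apply]; exact hy.2 _⟩
  have hinv : ∀ y ∈ K, r⁻¹ • (L y + r • y) ∈ K := by
    refine fun y hy => ⟨?_, fun s => ?_⟩
    · rw [map_smul, map_add, hℓL, map_smul, hy.1, zero_add, inv_smul_smul₀ hr.ne']
    · rw [map_smul, map_add, map_smul, exp_smul_comm_apply]
      exact smul_nonneg (inv_pos.2 hr).le (hL _ (hy.2 s))
  have hxK : x ∈ K := ⟨rfl, hx⟩
  ext k
  have h1 := apply_generator_nonpos L K hK r hr hflow hinv (ContinuousLinearMap.proj k) hxK
  have h2 := apply_generator_nonpos L K hK r hr hflow hinv (-ContinuousLinearMap.proj k) hxK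
  simp only [neg_apply, ContinuousLinearMap.proj_apply] at h1 h2
  exact le_antisymm h1 (by simpa using h2)

/-- A curve with `z' = a(t) L z` is the time change of the flow of `L`. -/
theorem eq_exp_smul_of_hasDerivAt {E : Type*} [NormedAddCommGroup E] [NormedSpace ℝ E]
    [CompleteSpace E] (L : E →L[ℝ] E) (a s : ℝ → ℝ) (z : ℝ → E)
    (hs : ∀ t, HasDerivAt s (a t) t) (hs0 : s 0 = 0)
    (hz : ∀ t, HasDerivAt z (a t • L (z t)) t) (t : ℝ) :
    z t = NormedSpace.exp (s t • L) (z 0) := by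
  have hd : ∀ t, HasDerivAt (fun t => NormedSpace.exp ((-s t) • L) (z t)) 0 t := by
    intro t
    have h1 := (hasDerivAt_exp_smul_const (𝕂 := ℝ) L (-s t)).scomp t (hs t).neg
    have h2 := h1.clm_apply (hz t)
    refine h2.congr_deriv ?_
    simp
  have h := is_const_of_deriv_eq_zero (fun t => (hd t).differentiableAt)
    (fun t => (hd t).deriv) t 0
  have h' := congrArg (fun y => NormedSpace.exp (s t • L) y) h
  simp only [exp_smul_add_apply, add_neg_cancel, hs0, neg_zero, zero_smul] at h'
  simpa using h'

theorem surjective_of_hasDerivAt_ge {s a : ℝ → ℝ} {c : ℝ} (hc : 0 < c)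
    (hs : ∀ t, HasDerivAt s (a t) t) (ha : ∀ t, c ≤ a t) : Function.Surjective s := by
  have hmono : Monotone (fun t => s t - c * t) := by
    refine monotone_of_hasDerivAt_nonneg (f' := fun t => a t - c) (fun t => ?_) fun t => ?_
    · simpa using (hs t).fun_sub ((hasDerivAt_id t).const_mul c)
    · exact sub_nonneg.2 (ha t)
  have hcont : Continuous s := continuous_iff_continuousAt.2 fun t => (hs t).continuousAt
  refine hcont.surjective ?_ ?_
  · refine tendsto_atTop_mono' _ (f₁ := fun t => c * t + s 0) ?_
      (tendsto_atTop_add_const_right _ _ (tendsto_id.const_mul_atTop hc))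
    filter_upwards [eventually_ge_atTop 0] with t ht
    have := hmono ht
    simp only [mul_zero, sub_zero] at this
    linarith
  · refine tendsto_atBot_mono' _ (f₁ := fun t => c * t + s 0) ?_
      (tendsto_atBot_add_const_right _ _ (tendsto_id.const_mul_atBot hc))
    filter_upwards [eventually_le_atBot 0] with t ht
    have := hmono ht
    simp only [mul_zero, sub_zero] at this
    linarith

/-- The only bounded solution of `f' = c - f` on the whole line is the constant one. -/
theorem eq_of_hasDerivAt_sub_self_of_bounded {f : ℝ → ℝ} {c B : ℝ}
    (hf : ∀ t, HasDerivAt f (c - f t) t) (hB : ∀ t, |f t| ≤ B) (t : ℝ) : f t = c := by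
  have hd : ∀ t, HasDerivAt (fun t => Real.exp t * (f t - c)) 0 t := fun t => by
    refine ((Real.hasDerivAt_exp t).mul ((hf t).sub_const c)).congr_deriv ?_
    ring
  have hconst := fun s => is_const_of_deriv_eq_zero (fun t => (hd t).differentiableAt)
    (fun t => (hd t).deriv) t s
  have hlim : Tendsto (fun s => Real.exp s * (f s - c)) atBot (𝓝 0) := by
    refine squeeze_zero_norm (a := fun s => Real.exp s * (B + |c|)) (fun s => ?_) ?_
    · rw [norm_mul, Real.norm_eq_abs, Real.abs_exp, Real.norm_eq_abs]
      gcongr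
      exact (abs_sub _ _).trans (by gcongr; exact hB s)
    · simpa using Real.tendsto_exp_atBot.mul_const (B + |c|)
  have h0 : Real.exp t * (f t - c) = 0 :=
    tendsto_nhds_unique (tendsto_const_nhds.congr hconst) hlim
  exact sub_eq_zero.1 ((mul_eq_zero.1 h0).resolve_left (Real.exp_ne_zero t))

/-- Points on a complete nonnegative orbit of the urn ODE are left eigenvectors. -/
theorem rmul_eq_smul_of_orbit {d : ℕ} (H : Fin d → Fin d → ℝ) (c : ℝ)
    (hH : ∀ q k, q ≠ k → 0 ≤ H q k) (u : Fin d → ℝ) (hu : ∀ k, 0 < u k)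
    (hHu : cmul H u = c • u) (C : ℝ) (θ : ℝ → Fin d → ℝ)
    (hode : ∀ t : ℝ, HasDerivAt θ (fun q => rmul (θ t) H q / asum (θ t) - θ t q) t)
    (hnn : ∀ t k, 0 ≤ θ t k) (hpos : ∀ t, 0 < asum (θ t)) (hC : ∀ t, asum (θ t) ≤ C) :
    rmul (θ 0) H = c • θ 0 := by
  set L := rmulShift H c with hLdef
  have hLapp : ∀ x, L x = rmul x H - c • x := rmulShift_apply H c
  have hCpos : 0 < C := (hpos 0).trans_le (hC 0)
  have hθ : Continuous θ := continuous_iff_continuousAt.2 fun t => (hode t).continuousAt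
  have hα : Continuous fun t => (asum (θ t))⁻¹ := by
    refine Continuous.inv₀ ?_ fun t => (hpos t).ne'
    unfold asum
    fun_prop
  set s : ℝ → ℝ := fun t => ∫ τ in (0 : ℝ)..t, (asum (θ τ))⁻¹ with hsdef
  have hs : ∀ t, HasDerivAt s (asum (θ t))⁻¹ t := fun t =>
    hα.integral_hasStrictDerivAt 0 t |>.hasDerivAt
  have hs0 : s 0 = 0 := by simp [hsdef]
  have hsurj : Function.Surjective s :=
    surjective_of_hasDerivAt_ge (inv_pos.2 hCpos) hs fun t => inv_anti₀ (hpos t) (hC t)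
  set z : ℝ → Fin d → ℝ := fun t => Real.exp (t - c * s t) • θ t with hzdef
  have hz : ∀ t, HasDerivAt z ((asum (θ t))⁻¹ • L (z t)) t := by
    intro t
    have h1 := ((hasDerivAt_id t).sub ((hs t).const_mul c)).exp
    refine (h1.smul (hode t)).congr_deriv ?_
    have hLz : L (z t) = Real.exp (t - c * s t) • (rmul (θ t) H - c • θ t) := by
      rw [← hLapp, ← map_smul]
    rw [hLz]
    ext q
    have := (hpos t).ne'
    simp only [Pi.add_apply, Pi.smul_apply, Pi.sub_apply, smul_eq_mul, id]
    field_simp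
    ring
  have hz0 : z 0 = θ 0 := by simp [hzdef, hs0]
  have hexp : ∀ σ : ℝ, 0 ≤ NormedSpace.exp (σ • L) (θ 0) := by
    intro σ
    obtain ⟨t, rfl⟩ := hsurj σ
    rw [← hz0, ← eq_exp_smul_of_hasDerivAt L _ s z hs hs0 hz t]
    exact smul_nonneg (Real.exp_pos _).le (hnn t)
  have hLu : ∀ x, ∑ k, L x k * u k = 0 := by
    intro x
    have h1 : ∑ q, rmul x H q * u q = ∑ k, x k * cmul H u k := by
      simp only [rmul, cmul, Finset.sum_mul, Finset.mul_sum, mul_assoc]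
      exact Finset.sum_comm
    simp only [hLapp, Pi.sub_apply, sub_mul, Finset.sum_sub_distrib, h1, hHu, Pi.smul_apply,
      smul_eq_mul]
    rw [sub_eq_zero]
    exact Finset.sum_congr rfl fun k _ => by ring
  set r : ℝ := ∑ k, |H k k| + |c| + 1 with hr
  have hL : ∀ x, 0 ≤ x → 0 ≤ L x + r • x := by
    intro x hx q
    have h1 : x q * H q q ≤ rmul x H q := by
      rw [rmul, ← Finset.add_sum_erase Finset.univ (fun k => x k * H k q) (Finset.mem_univ q)]
      refine le_add_of_nonneg_right ?_
      exact Finset.sum_nonneg fun k hk => mul_nonneg (hx k) (hH k q (Finset.ne_of_mem_erase hk))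
    have h2 : |H q q| ≤ ∑ k, |H k k| :=
      Finset.single_le_sum (f := fun k => |H k k|) (fun _ _ => abs_nonneg _) (Finset.mem_univ q)
    have h3 : 0 ≤ x q * (H q q - c + r) := by
      refine mul_nonneg (hx q) ?_
      linarith [neg_abs_le (H q q), le_abs_self c]
    simp only [hLapp, Pi.zero_apply, Pi.add_apply, Pi.sub_apply, Pi.smul_apply, smul_eq_mul]
    linarith
  have hzero := apply_eq_zero_of_exp_nonneg L u hu hLu r (by positivity) hL (θ 0) hexp
  rw [hLapp] at hzero
  exact sub_eq_zero.1 hzero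

end Urn

/-- Lemma 4.0: let `H` satisfy A3 with positive right
eigenvector `u`, and let `Θ₀ = {θ ≥ 0 : α(θ) ≤ C₀, θ·uᵗ ≥ c₀} ⊇ λ_H S_H`
with `c₀ > 0`. If `θ : ℝ → ℝ^d` solves `θ' = −h(θ)` with
`h(θ) = θ(I − H/α(θ))` and its whole path stays in `Θ₀`, then
`θ(0) ∈ λ_H S_H` and `θ` is constant. -/
theorem stmt16
    {d : ℕ} (H : Fin d → Fin d → ℝ) (hA3 : Urn.A3 H)
    (u : Fin d → ℝ) (hu : ∀ k, 0 < u k)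
    (hueig : Urn.cmul H u = Urn.lamH H • u)
    (c0 C0 : ℝ) (hc0 : 0 < c0)
    (Θ0 : Set (Fin d → ℝ))
    (hΘ0 : Θ0 = {θ | (∀ k, 0 ≤ θ k) ∧ Urn.asum θ ≤ C0 ∧ c0 ≤ ∑ k, θ k * u k})
    (hsub : Urn.lamSH H ⊆ Θ0)
    (θ : ℝ → Fin d → ℝ)
    (hode : ∀ t : ℝ, HasDerivAt θ
      (fun q => Urn.rmul (θ t) H q / Urn.asum (θ t) - θ t q) t)
    (hpath : ∀ t : ℝ, θ t ∈ Θ0) :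
    θ 0 ∈ Urn.lamSH H ∧ ∀ t : ℝ, θ t = θ 0 := by
  obtain ⟨hH, -, hlam⟩ := hA3
  subst hΘ0
  have hnn : ∀ t k, 0 ≤ θ t k := fun t => (hpath t).1
  have hpos : ∀ t, 0 < Urn.asum (θ t) := by
    intro t
    refine (Finset.sum_nonneg fun k _ => hnn t k).lt_of_ne fun h => ?_
    have hzero := (Finset.sum_eq_zero_iff_of_nonneg fun k _ => hnn t k).1 h.symm
    have hle := (hpath t).2.2
    rw [Finset.sum_eq_zero fun k hk => by rw [hzero k hk, zero_mul]] at hle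
    exact absurd hc0 hle.not_gt
  have heig : ∀ t, Urn.rmul (θ t) H = Urn.lamH H • θ t := by
    intro t
    have := Urn.rmul_eq_smul_of_orbit H (Urn.lamH H) hH u hu hueig C0 (fun τ => θ (τ + t))
      (fun τ => (hode (τ + t)).comp_add_const τ t) (fun τ => hnn _) (fun τ => hpos _)
      (fun τ => (hpath _).2.1)
    simpa using this
  have hsum : ∀ t, Urn.asum (θ t) = Urn.lamH H := by
    refine Urn.eq_of_hasDerivAt_sub_self_of_bounded (B := C0) (fun t => ?_) fun t => ?_
    · have h1 := HasDerivAt.fun_sum (u := Finset.univ) fun k _ => (hasDerivAt_pi.1 (hode t)) k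
      refine h1.congr_deriv ?_
      have h2 := (hpos t).ne'
      simp only [heig, Pi.smul_apply, smul_eq_mul, Finset.sum_sub_distrib, ← Finset.sum_div,
        ← Finset.mul_sum]
      change Urn.lamH H * Urn.asum (θ t) / Urn.asum (θ t) - Urn.asum (θ t) = _
      field_simp
    · rw [abs_of_pos (hpos t)]
      exact (hpath t).2.1
  have hderiv : ∀ t, HasDerivAt θ 0 t := by
    intro t
    refine (hode t).congr_deriv ?_
    ext q
    simp [heig, hsum, hlam.ne']
  refine ⟨⟨(Urn.lamH H)⁻¹ • θ 0, ⟨⟨fun k => ?_, ?_⟩, ?_⟩, ?_⟩, fun t => ?_⟩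
  · exact mul_nonneg (inv_pos.2 hlam).le (hnn 0 k)
  · have h := hsum 0
    simp only [Urn.asum] at h
    simp only [Pi.smul_apply, smul_eq_mul, ← Finset.mul_sum, h]
    exact inv_mul_cancel₀ hlam.ne'
  · have h : Urn.rmul ((Urn.lamH H)⁻¹ • θ 0) H = (Urn.lamH H)⁻¹ • Urn.rmul (θ 0) H := by
      ext q
      simp [Urn.rmul, Finset.mul_sum, mul_assoc]
    rw [h, heig, smul_comm]
  · exact smul_inv_smul₀ hlam.ne' _
  · exact is_const_of_deriv_eq_zero (fun t => (hderiv t).differentiableAt)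
      (fun t => (hderiv t).deriv) t 0
end
end

section
/- Let ξ be a nonnegative random variable with E[ξ·log⁺ξ] < ∞, let ε > 0, and set c_m = m/(log m)^{1+ε} for m ≥ 2. Then Σ_{m=2}^∞ (1/m)·E[ξ·1{ξ ≥ c_m}] < ∞. In particular, if (D_n) are i.i.d. random d×d matrices with E[|D_{q,k}(1)|·log⁺|D_{q,k}(1)|] < ∞ for all q,k, then Σ_{m=2}^∞ (1/m)·E[|D_{q,k}(m)|·1{|D_{q,k}(m)| ≥ c_m} | ℱ_{m-1}] < ∞ a.s. for all q,k. -/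
open MeasureTheory Filter Topology Finset ProbabilityTheory Asymptotics

noncomputable section

/-- The indicator-weighted harmonic sum over the indices whose threshold `c_m` is at most `x`
grows at most logarithmically in `x`. -/
theorem Urn.exists_sum_threshold_le_log (ε : ℝ) (hε : 0 < ε) :
    ∃ K : ℝ, ∀ x : ℝ, ∀ n : ℕ,
      ∑ j ∈ Finset.range n, (1 / ((j+2:ℕ):ℝ)) *
        (if ((j+2:ℕ):ℝ) / (Real.log (j+2:ℕ)) ^ ((1:ℝ) + ε) ≤ x then (1:ℝ) else 0)
      ≤ K * (1 + Real.log (max x 1)) := by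
  have hp : (0:ℝ) < 1 + ε := by linarith
  set δ : ℝ := 1 / (2 * (1 + ε)) with hδ
  have hδ0 : 0 < δ := by positivity
  have hδ1 : δ ≤ 1 := by
    rw [hδ, div_le_one (by positivity)]; linarith
  set C : ℝ := (1 / δ) ^ (1 + ε) with hC
  have hC1 : 1 ≤ C := Real.one_le_rpow ((one_le_div hδ0).2 hδ1) hp.le
  have hlogC : 0 ≤ Real.log C := Real.log_nonneg hC1
  refine ⟨3 + 2 * Real.log C, fun x n => ?_⟩
  set X : ℝ := max x 1 with hX
  have hX1 : 1 ≤ X := le_max_right _ _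
  have hlogX : 0 ≤ Real.log X := Real.log_nonneg hX1
  have hCX : 1 ≤ C * X := one_le_mul_of_one_le_of_one_le hC1 hX1
  have key : ∀ j : ℕ, ((j+2:ℕ):ℝ) / (Real.log (j+2:ℕ)) ^ ((1:ℝ) + ε) ≤ x →
      ((j+2:ℕ):ℝ) ≤ (C * X) ^ 2 := by
    intro j hj
    set m : ℝ := ((j+2:ℕ):ℝ) with hm
    have hm1 : 1 < m := by rw [hm]; push_cast; linarith [(Nat.cast_nonneg j : (0:ℝ) ≤ j)]
    have hm0 : 0 < m := by linarith
    have hlog : 0 < Real.log m := Real.log_pos hm1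
    have hL : (Real.log m) ^ (1 + ε) ≤ C * √m := by
      calc (Real.log m) ^ (1 + ε) ≤ (m ^ δ / δ) ^ (1 + ε) :=
            Real.rpow_le_rpow hlog.le (Real.log_le_rpow_div hm0.le hδ0) hp.le
        _ = (1 / δ * m ^ δ) ^ (1 + ε) := by ring_nf
        _ = C * (m ^ δ) ^ (1 + ε) := by
            rw [Real.mul_rpow (by positivity) (by positivity)]
        _ = C * √m := by
            rw [← Real.rpow_mul hm0.le, Real.sqrt_eq_rpow, hδ]
            congr 2
            field_simp
    have h1 : m ≤ X * (Real.log m) ^ (1 + ε) :=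
      (div_le_iff₀ (Real.rpow_pos_of_pos hlog _)).1 (hj.trans (le_max_left _ _))
    have h2 : √m * √m ≤ (C * X) * √m := by
      rw [Real.mul_self_sqrt hm0.le]
      calc m ≤ X * (Real.log m) ^ (1 + ε) := h1
        _ ≤ X * (C * √m) := by gcongr
        _ = (C * X) * √m := by ring
    have h3 : √m ≤ C * X := le_of_mul_le_mul_right h2 (Real.sqrt_pos.2 hm0)
    calc m = √m ^ 2 := (Real.sq_sqrt hm0.le).symm
      _ ≤ (C * X) ^ 2 := by gcongr
  have hsum : ∑ j ∈ Finset.range n, (1 / ((j+2:ℕ):ℝ)) *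
        (if ((j+2:ℕ):ℝ) / (Real.log (j+2:ℕ)) ^ ((1:ℝ) + ε) ≤ x then (1:ℝ) else 0)
      ≤ ∑ j ∈ Finset.range ⌊(C * X) ^ 2⌋₊, ((j:ℝ) + 1)⁻¹ := by
    simp only [mul_ite, mul_one, mul_zero]
    rw [← Finset.sum_filter]
    refine (Finset.sum_le_sum (g := fun j : ℕ => ((j:ℝ) + 1)⁻¹) fun j _ => ?_).trans
      (Finset.sum_le_sum_of_subset_of_nonneg (fun j hj => ?_) fun j _ _ => by positivity)
    · rw [one_div]
      apply inv_anti₀ (by positivity)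
      push_cast
      linarith
    · have := Nat.le_floor (key j (Finset.mem_filter.1 hj).2)
      exact Finset.mem_range.2 (by omega)
  have hharm := harmonic_floor_le_one_add_log ((C * X) ^ 2) (one_le_pow₀ hCX)
  rw [harmonic] at hharm
  push_cast at hharm
  have hlogCX : Real.log ((C * X) ^ 2) = 2 * Real.log C + 2 * Real.log X := by
    rw [Real.log_pow, Real.log_mul (by positivity) (by positivity)]
    push_cast
    ring
  nlinarith [mul_nonneg hlogC hlogX]

theorem Urn.le_exp_one_add_mul_log {x : ℝ} :
    x ≤ Real.exp 1 + x * Real.log (max x 1) := by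
  rcases le_total x (Real.exp 1) with h | h
  · rcases le_total x 1 with h1 | h1
    · simpa [max_eq_right h1] using h
    · have := mul_nonneg (zero_le_one.trans h1) (Real.log_nonneg (le_max_right x 1))
      linarith
  · have hx : 1 ≤ x := (Real.one_le_exp zero_le_one).trans h
    have : 1 ≤ Real.log x := (Real.le_log_iff_exp_le (by linarith)).2 h
    rw [max_eq_left hx]
    nlinarith [Real.exp_pos 1]

/-- The `L log L` moment condition implies summability of the weighted truncated tails. -/
theorem Urn.summable_integral_threshold {Ω : Type*} {m0 : MeasurableSpace Ω} (μ : Measure Ω)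
    [IsFiniteMeasure μ] (ξ : Ω → ℝ) (hξmeas : Measurable ξ) (hξnn : ∀ ω, 0 ≤ ξ ω)
    (hξ : Integrable (fun ω => ξ ω * Real.log (max (ξ ω) 1)) μ) (ε : ℝ) (hε : 0 < ε) :
    Summable (fun j : ℕ => (1 / ((j+2:ℕ):ℝ)) *
      ∫ ω, ξ ω * (if ((j+2:ℕ):ℝ) / (Real.log (j+2:ℕ)) ^ ((1:ℝ) + ε) ≤ ξ ω
        then 1 else 0) ∂μ) := by
  obtain ⟨K, hK⟩ := Urn.exists_sum_threshold_le_log ε hε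
  have hint : Integrable ξ μ := by
    refine ((integrable_const (Real.exp 1)).add hξ).mono' hξmeas.aestronglyMeasurable
      (.of_forall fun ω => ?_)
    rw [Real.norm_of_nonneg (hξnn ω)]
    exact Urn.le_exp_one_add_mul_log
  have hterm : ∀ j : ℕ, Integrable (fun ω => ξ ω *
      (if ((j+2:ℕ):ℝ) / (Real.log (j+2:ℕ)) ^ ((1:ℝ) + ε) ≤ ξ ω then (1:ℝ) else 0)) μ := by
    intro j
    refine hint.mono' (hξmeas.mul (Measurable.ite (measurableSet_le measurable_const hξmeas)
      measurable_const measurable_const)).aestronglyMeasurable (.of_forall fun ω => ?_)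
    have := hξnn ω
    split_ifs <;> simp [abs_of_nonneg, this]
  refine summable_of_sum_range_le
    (c := ∫ ω, K * (ξ ω + ξ ω * Real.log (max (ξ ω) 1)) ∂μ) (fun j => ?_) fun n => ?_
  · refine mul_nonneg (by positivity) (integral_nonneg fun ω => mul_nonneg (hξnn ω) ?_)
    split_ifs <;> simp
  · simp_rw [← integral_const_mul]
    rw [← integral_finsetSum _ fun j _ => (hterm j).const_mul _]
    refine integral_mono (integrable_finsetSum _ fun j _ => (hterm j).const_mul _)
      ((hint.add hξ).const_mul K) fun ω => ?_
    simp only [mul_left_comm _ (ξ ω)]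
    rw [← Finset.mul_sum]
    calc _ ≤ ξ ω * (K * (1 + Real.log (max (ξ ω) 1))) :=
          mul_le_mul_of_nonneg_left (hK (ξ ω) n) (hξnn ω)
      _ = _ := by ring

/-- Remark 3.2: if `ξ ≥ 0` with `E[ξ log⁺ ξ] < ∞` and
`c_m = m/(log m)^{1+ε}`, then `∑_{m≥2} (1/m) E[ξ 1{ξ ≥ c_m}] < ∞`; in
particular, for i.i.d. replacement matrices with
`E[|D_{q,k}| log⁺|D_{q,k}|] < ∞`, the conditional version
`∑_{m≥2} (1/m) E[|D_{q,k}(m)| 1{|D_{q,k}(m)| ≥ c_m} | ℱ_{m-1}] < ∞` holds a.s. -/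
theorem stmt18
    {Ω : Type*} {m0 : MeasurableSpace Ω} (μ : Measure Ω) [IsProbabilityMeasure μ]
    (ℱ : Filtration ℕ m0) {d : ℕ}
    (ξ : Ω → ℝ) (hξmeas : Measurable ξ) (hξnn : ∀ ω, 0 ≤ ξ ω)
    (hξ : Integrable (fun ω => ξ ω * Real.log (max (ξ ω) 1)) μ)
    (ε : ℝ) (hε : 0 < ε)
    (D : ℕ → Ω → Fin d → Fin d → ℝ)
    (hA1 : Urn.IsIID μ ℱ D)
    (hD : ∀ q k, Integrable
      (fun ω => |D 1 ω q k| * Real.log (max |D 1 ω q k| 1)) μ) :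
    Summable (fun j : ℕ => (1 / ((j+2:ℕ):ℝ)) *
      ∫ ω, ξ ω * (if ((j+2:ℕ):ℝ) / (Real.log (j+2:ℕ)) ^ ((1:ℝ) + ε) ≤ ξ ω
        then 1 else 0) ∂μ) ∧
    ∀ q k, ∀ᵐ ω ∂μ, Summable (fun j : ℕ => (1 / ((j+2:ℕ):ℝ)) *
      (μ[fun ω' => |D (j+2) ω' q k| *
        (if ((j+2:ℕ):ℝ) / (Real.log (j+2:ℕ)) ^ ((1:ℝ) + ε) ≤ |D (j+2) ω' q k|
          then 1 else 0) | ℱ (j+1)]) ω) := by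
  refine ⟨Urn.summable_integral_threshold μ ξ hξmeas hξnn hξ ε hε, fun q k => ?_⟩
  obtain ⟨hmeas, hident, hindep⟩ := hA1
  have hentry : Measurable fun A : Fin d → Fin d → ℝ => |A q k| := by
    have : Measurable fun A : Fin d → Fin d → ℝ => A q k := by fun_prop
    exact this.abs
  have hS := Urn.summable_integral_threshold μ (fun ω => |D 1 ω q k|)
    (hentry.comp (hmeas 1 le_rfl)) (fun _ => abs_nonneg _) (hD q k) ε hε
  have hcond : ∀ j : ℕ,
      (μ[fun ω' => |D (j+2) ω' q k| *
        (if ((j+2:ℕ):ℝ) / (Real.log (j+2:ℕ)) ^ ((1:ℝ) + ε) ≤ |D (j+2) ω' q k|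
          then 1 else 0) | ℱ (j+1)]) =ᵐ[μ] fun _ => ∫ ω, |D 1 ω q k| *
        (if ((j+2:ℕ):ℝ) / (Real.log (j+2:ℕ)) ^ ((1:ℝ) + ε) ≤ |D 1 ω q k|
          then 1 else 0) ∂μ := by
    intro j
    have hg : Measurable fun A : Fin d → Fin d → ℝ => |A q k| *
        (if ((j+2:ℕ):ℝ) / (Real.log (j+2:ℕ)) ^ ((1:ℝ) + ε) ≤ |A q k|
          then (1:ℝ) else 0) :=
      hentry.mul (Measurable.ite (measurableSet_le measurable_const hentry)
        measurable_const measurable_const)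
    have hDj : Measurable (D (j+2)) := hmeas (j+2) (by omega)
    refine (condExp_indep_eq hDj.comap_le (ℱ.le (j+1))
      (hg.comp (comap_measurable (D (j+2)))).stronglyMeasurable (hindep (j+1))).trans ?_
    refine .of_forall fun _ => ?_
    have h1 := integral_map (μ := μ) hDj.aemeasurable hg.aestronglyMeasurable
    have h2 := integral_map (μ := μ) (hmeas 1 le_rfl).aemeasurable hg.aestronglyMeasurable
    rw [hident (j+2) (by omega)] at h1
    exact h1.symm.trans h2
  filter_upwards [ae_all_iff.2 hcond] with ω hω
  simpa only [hω] using hS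
end
end
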